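/- arXiv:1711.11202 — 9 statements merged into one kernel-verified Lean document; each statement's English description precedes it below -/
import Mathlib

section
/- Let q be a prime power, m, n positive integers with n ≤ m, g_1, …, g_n ∈ F_{q^m} linearly independent over F_q, and 1 ≤ k ≤ n. Let f be a q-linearized polynomial over F_{q^m} with k ≤ deg_q(f) < n and let σ_f = (f(g_1), …, f(g_n)) ∈ F_{q^m}^n. Then d_R(σ_f, G) ≥ n − deg_q(f), where G is the Gabidulin code of dimension k. -/
/-- The Gabidulin code of dimension `k`: evaluations of `q`-linearized polynomials
of `q`-degree less than `k` at the points `g 0, …, g (n-1)`. -/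
def gabidulinCode (q : ℕ) {F : Type} [Field F] {n : ℕ} (g : Fin n → F) (k : ℕ) :
    Set (Fin n → F) :=
  {c | ∃ v : Fin k → F, c = fun j => ∑ i : Fin k, v i * g j ^ q ^ (i : ℕ)}

/-- The rank distance from a word `u` to a set of words `G`: the minimum over `c ∈ G`
of the `Fq`-dimension of the `Fq`-span of the coordinates of `u - c`. -/
noncomputable def rankDistTo (Fq : Type) [Field Fq] {F : Type} [Field F] [Algebra Fq F]
    {n : ℕ} (u : Fin n → F) (G : Set (Fin n → F)) : ℕ :=
  sInf {r : ℕ | ∃ c ∈ G, r = Module.finrank Fq (Submodule.span Fq (Set.range (u - c)))}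

open Polynomial in
/-- A `q`-linearized polynomial of `q`-degree `D`, seen as an `Fq`-linear map, has kernel of
dimension at most `D`. -/
theorem finrank_ker_linearized_le (Fq : Type*) {F : Type*} [Field Fq] [Fintype Fq] [Field F]
    [Finite F] [Algebra Fq F] (L : F →ₗ[Fq] F) (D : ℕ) (b : ℕ → F) (hb : b D ≠ 0)
    (hL : ∀ x, L x = ∑ i ∈ Finset.range (D + 1), b i * x ^ Fintype.card Fq ^ i) :
    Module.finrank Fq (LinearMap.ker L) ≤ D := by
  classical
  have := Fintype.ofFinite F
  have hq : 1 < Fintype.card Fq := Fintype.one_lt_card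
  set P : F[X] := ∑ i ∈ Finset.range (D + 1), C (b i) * X ^ Fintype.card Fq ^ i with hP
  have hP0 : P ≠ 0 := by
    intro h
    have hc : P.coeff (Fintype.card Fq ^ D) = b D := by
      simp only [hP, finsetSum_coeff, coeff_C_mul, coeff_X_pow]
      rw [Finset.sum_eq_single D]
      · simp
      · intro i _ hi
        rw [if_neg fun h => hi (Nat.pow_right_injective hq h).symm, mul_zero]
      · simp
    exact hb (by rw [← hc, h, coeff_zero])
  have hdeg : P.natDegree ≤ Fintype.card Fq ^ D := by
    refine natDegree_sum_le_of_forall_le _ _ fun i hi => ?_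
    refine (natDegree_C_mul_X_pow_le _ _).trans (Nat.pow_le_pow_right hq.le ?_)
    exact Nat.lt_succ_iff.mp (Finset.mem_range.mp hi)
  have hroots : (LinearMap.ker L : Set F).toFinset.val ⊆ P.roots := by
    intro x hx
    have hx0 : L x = 0 := by simpa using hx
    rw [mem_roots hP0, IsRoot, hP, eval_finsetSum, ← hx0, hL]
    simp
  have hcard := card_le_degree_of_subset_roots hroots
  rw [Set.toFinset_card, ← Nat.card_eq_fintype_card] at hcard
  have hker : Nat.card (LinearMap.ker L) =
      Fintype.card Fq ^ Module.finrank Fq (LinearMap.ker L) := by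
    rw [Module.natCard_eq_pow_finrank (K := Fq), Nat.card_eq_fintype_card]
  exact (Nat.pow_le_pow_iff_right hq).mp (hker ▸ hcard.trans hdeg)

/-- The evaluation of a linear map with kernel of dimension at most `D` at `n` linearly independent
points has rank weight at least `n - D`. -/
theorem le_finrank_span_range_comp {K V W : Type*} [Field K] [AddCommGroup V] [Module K V]
    [FiniteDimensional K V] [AddCommGroup W] [Module K W] (L : V →ₗ[K] W) {n D : ℕ}
    (hL : Module.finrank K (LinearMap.ker L) ≤ D) {g : Fin n → V} (hg : LinearIndependent K g) :
    n - D ≤ Module.finrank K (Submodule.span K (Set.range (L ∘ g))) := by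
  set S := Submodule.span K (Set.range g) with hS
  have hmap : S.map L = Submodule.span K (Set.range (L ∘ g)) := by
    rw [hS, Submodule.map_span, ← Set.range_comp]
  have hn : Module.finrank K S = n := by simpa using finrank_span_eq_card hg
  have hrk := LinearMap.finrank_range_add_finrank_ker (L.domRestrict S)
  have hinj : Module.finrank K (LinearMap.ker (L.domRestrict S)) ≤
      Module.finrank K (LinearMap.ker L) := by
    rw [LinearMap.ker_domRestrict, ← Submodule.finrank_map_subtype_eq]
    exact Submodule.finrank_mono (by rintro _ ⟨x, hx, rfl⟩; exact hx)
  rw [LinearMap.range_domRestrict, hmap] at hrk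
  omega

/-- Theorem 1 (lower bound, rank metric): if `f` is a `q`-linearized polynomial with
`k ≤ deg_q f = D < n`, then `d_R(σ_f, G) ≥ n - D`. -/
theorem rank_dist_lower_bound
    (q m n k : ℕ) (hq : IsPrimePow q) (hm : 0 < m) (hn : 0 < n) (hnm : n ≤ m)
    (Fq F : Type) [Field Fq] [Fintype Fq] [Field F] [Fintype F] [Algebra Fq F]
    (hcardFq : Fintype.card Fq = q) (hcardF : Fintype.card F = q ^ m)
    (g : Fin n → F) (hg : LinearIndependent Fq g)
    (hk : 1 ≤ k) (hkn : k ≤ n)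
    (D : ℕ) (hkD : k ≤ D) (hDn : D < n)
    (a : ℕ → F) (haD : a D ≠ 0) (htop : ∀ i, D < i → a i = 0)
    (σf : Fin n → F)
    (hσf : σf = fun j => ∑ i ∈ Finset.range (D + 1), a i * g j ^ q ^ i) :
    n - D ≤ rankDistTo Fq σf (gabidulinCode q g k) := by
  have hne : {r : ℕ | ∃ c ∈ gabidulinCode q g k,
      r = Module.finrank Fq (Submodule.span Fq (Set.range (σf - c)))}.Nonempty :=
    ⟨_, _, ⟨0, rfl⟩, rfl⟩
  obtain ⟨c, ⟨v, rfl⟩, hc⟩ := Nat.sInf_mem hne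
  rw [rankDistTo, hc]
  set w : ℕ → F := fun i => if h : i < k then v ⟨i, h⟩ else 0 with hw
  let L : F →ₗ[Fq] F := ∑ i ∈ Finset.range (D + 1),
    (a i - w i) • (FiniteField.frobeniusAlgHom Fq F ^ i).toLinearMap
  have hL : ∀ x, L x = ∑ i ∈ Finset.range (D + 1), (a i - w i) * x ^ Fintype.card Fq ^ i := by
    intro x
    simp [L, LinearMap.sum_apply, AlgHom.coe_pow, FiniteField.coe_frobeniusAlgHom, pow_iterate]
  have hker := finrank_ker_linearized_le Fq L D (fun i => a i - w i)
    (by simpa [hw, hkD.not_gt] using haD) hL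
  have hσ : σf - (fun j => ∑ i : Fin k, v i * g j ^ q ^ (i : ℕ)) = L ∘ g := by
    funext j
    have hv : ∑ i : Fin k, v i * g j ^ q ^ (i : ℕ) =
        ∑ i ∈ Finset.range (D + 1), w i * g j ^ q ^ i := by
      rw [← Finset.sum_subset (Finset.range_subset_range.mpr (hkD.trans D.le_succ)),
        Finset.sum_range]
      · simp [hw]
      · intro i _ hi
        simp [hw, Finset.mem_range.not.mp hi]
    simp only [Pi.sub_apply, Function.comp_apply, hσf, hL, hv, hcardFq, sub_mul,
      Finset.sum_sub_distrib]
  rw [hσ]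
  exact le_finrank_span_range_comp L hker hg
end

section
/- Let q be a prime power, m, n positive integers with n ≤ m, g_1, …, g_n ∈ F_{q^m} linearly independent over F_q, and 1 ≤ k ≤ n. Let f be a monic q-linearized polynomial over F_{q^m} with k ≤ deg_q(f) < n and let σ_f = (f(g_1), …, f(g_n)). Then d_R(σ_f, G) = n − deg_q(f) if and only if there exist an F_q-subspace H of ⟨g_1, …, g_n⟩ of dimension deg_q(f) and a q-linearized polynomial v over F_{q^m} with deg_q(v) ≤ k − 1 such that f(x) − v(x) = ∏_{h ∈ H} (x − h). -/
open Polynomial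

/-- The `q`-linearized polynomial `∑_{i ≤ D} p_i X^{q^i}` with `q = #K`. -/
noncomputable def linearizedPoly (K : Type) [Fintype K] {F : Type} [Field F]
    (p : ℕ → F) (D : ℕ) : Polynomial F :=
  ∑ i ∈ Finset.range (D + 1), C (p i) * X ^ Fintype.card K ^ i

/-- The `K`-linear map `x ↦ ∑_{i ≤ D} p_i x^{q^i}` with `q = #K`. -/
noncomputable def linearizedMap (K : Type) [Field K] [Fintype K] {F : Type} [Field F]
    [Algebra K F] (p : ℕ → F) (D : ℕ) : F →ₗ[K] F :=
  ∑ i ∈ Finset.range (D + 1),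
    LinearMap.mulLeft K (p i) ∘ₗ (FiniteField.frobeniusAlgHom K F ^ i).toLinearMap

section

variable {K : Type} [Field K] [Fintype K] {F : Type} [Field F] [Algebra K F]

theorem linearizedMap_apply (p : ℕ → F) (D : ℕ) (x : F) :
    linearizedMap K p D x = ∑ i ∈ Finset.range (D + 1), p i * x ^ Fintype.card K ^ i := by
  simp [linearizedMap, AlgHom.coe_pow, FiniteField.coe_frobeniusAlgHom, pow_iterate]

theorem eval_linearizedPoly (p : ℕ → F) (D : ℕ) (x : F) :
    (linearizedPoly K p D).eval x = linearizedMap K p D x := by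
  simp [linearizedMap_apply, linearizedPoly, eval_finsetSum]

omit [Algebra K F] in
theorem degree_linearizedPoly_lower_lt (p : ℕ → F) (D : ℕ) :
    (∑ i ∈ Finset.range D, C (p i) * X ^ Fintype.card K ^ i).degree <
      ((Fintype.card K ^ D : ℕ) : WithBot ℕ) := by
  refine (degree_sum_le _ _).trans_lt ((Finset.sup_lt_iff (WithBot.bot_lt_coe _)).2 fun i hi => ?_)
  refine (degree_C_mul_X_pow_le _ _).trans_lt ?_
  exact_mod_cast Nat.pow_lt_pow_right Fintype.one_lt_card (Finset.mem_range.1 hi)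

omit [Algebra K F] in
theorem linearizedPoly_monic {p : ℕ → F} {D : ℕ} (hp : p D = 1) :
    (linearizedPoly K p D).Monic := by
  rw [linearizedPoly, Finset.sum_range_succ, hp, C_1, one_mul, add_comm]
  exact monic_X_pow_add (degree_linearizedPoly_lower_lt p D)

omit [Algebra K F] in
theorem natDegree_linearizedPoly {p : ℕ → F} {D : ℕ} (hp : p D = 1) :
    (linearizedPoly K p D).natDegree = Fintype.card K ^ D := by
  rw [linearizedPoly, Finset.sum_range_succ, hp, C_1, one_mul, add_comm]
  refine natDegree_eq_of_degree_eq_some ?_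
  rw [degree_add_eq_left_of_degree_lt, degree_X_pow]
  rw [degree_X_pow]
  exact degree_linearizedPoly_lower_lt p D

theorem eq_prod_X_sub_C_of_monic_of_card {P : Polynomial F} (hP : P.Monic) {S : Finset F}
    (hS : ∀ h ∈ S, P.eval h = 0) (hcard : P.natDegree = S.card) :
    P = ∏ h ∈ S, (X - C h) := by
  have hle : S.val ≤ P.roots := (Multiset.le_iff_subset S.nodup).2 fun h hh =>
    (mem_roots hP.ne_zero).2 (hS h hh)
  have heq : S.val = P.roots :=
    Multiset.eq_of_le_of_card_le hle ((card_roots' P).trans hcard.le)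
  have h := prod_multiset_X_sub_C_of_monic_of_roots_card_eq hP (by rw [← heq, hcard]; rfl)
  rw [← heq] at h
  exact h.symm

variable [Fintype F]

theorem finrank_le_of_le_ker {p : ℕ → F} {D : ℕ} (hp : p D = 1) {H : Submodule K F}
    (hH : H ≤ LinearMap.ker (linearizedMap K p D)) : Module.finrank K H ≤ D := by
  classical
  have hcard : (H : Set F).toFinset.card = Fintype.card K ^ Module.finrank K H := by
    rw [Set.toFinset_card]
    exact Module.card_eq_pow_finrank
  have hle : (H : Set F).toFinset.card ≤ (linearizedPoly K p D).natDegree :=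
    card_le_degree_of_subset_roots fun h hh => by
      refine (mem_roots (linearizedPoly_monic hp).ne_zero).2 ?_
      rw [IsRoot, eval_linearizedPoly]
      exact hH (by simpa using hh)
  rw [hcard, natDegree_linearizedPoly hp] at hle
  exact (Nat.pow_le_pow_iff_right Fintype.one_lt_card).1 hle

open scoped Classical in
theorem linearizedPoly_eq_prod_iff {p : ℕ → F} {D : ℕ} (hp : p D = 1) {H : Submodule K F}
    (hD : Module.finrank K H = D) :
    linearizedPoly K p D = ∏ h ∈ (H : Set F).toFinset, (X - C h) ↔
      H ≤ LinearMap.ker (linearizedMap K p D) := by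
  constructor
  · intro h x hx
    rw [LinearMap.mem_ker, ← eval_linearizedPoly, h, eval_prod]
    exact Finset.prod_eq_zero (i := x) (by simpa using hx) (by simp)
  · intro h
    refine eq_prod_X_sub_C_of_monic_of_card (linearizedPoly_monic hp) (fun x hx => ?_) ?_
    · rw [eval_linearizedPoly]
      exact h (by simpa using hx)
    · rw [natDegree_linearizedPoly hp, Set.toFinset_card, ← hD]
      exact Module.card_eq_pow_finrank.symm

omit [Fintype K] in
theorem finrank_span_range_comp_add_finrank_ker {n : ℕ} {g : Fin n → F}
    (hg : LinearIndependent K g) (L : F →ₗ[K] F) :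
    Module.finrank K (Submodule.span K (Set.range fun j => L (g j))) +
      Module.finrank K ↥(Submodule.span K (Set.range g) ⊓ LinearMap.ker L) = n := by
  set W := Submodule.span K (Set.range g) with hW
  have hrank := (L.domRestrict W).finrank_range_add_finrank_ker
  rw [LinearMap.range_domRestrict, LinearMap.ker_domRestrict, hW, Submodule.map_span,
    ← Set.range_comp, ← hW, finrank_span_eq_card hg, Fintype.card_fin] at hrank
  rw [← Submodule.map_comap_subtype, Submodule.finrank_map_subtype_eq]
  exact hrank

omit [Fintype K] [Fintype F] in
theorem rankDistTo_eq_iff_exists {n : ℕ} {u : Fin n → F} {G : Set (Fin n → F)} {r : ℕ}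
    (hr : 0 < r)
    (hG : ∀ c ∈ G, r ≤ Module.finrank K (Submodule.span K (Set.range (u - c)))) :
    rankDistTo K u G = r ↔
      ∃ c ∈ G, Module.finrank K (Submodule.span K (Set.range (u - c))) = r := by
  constructor
  · intro h
    have hmem := Nat.sInf_mem (Nat.nonempty_of_pos_sInf (h.symm ▸ hr : 0 < rankDistTo K u G))
    obtain ⟨c, hc, hcr⟩ := hmem
    exact ⟨c, hc, hcr.symm.trans h⟩
  · rintro ⟨c, hc, hcr⟩
    refine le_antisymm (Nat.sInf_le ⟨c, hc, hcr.symm⟩) (le_csInf ⟨_, c, hc, rfl⟩ ?_)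
    rintro _ ⟨c', hc', rfl⟩
    exact hG c' hc'

end

open scoped Classical in
/-- Theorem 1 (equality case, rank metric): for monic `f` with `k ≤ deg_q f = D < n`,
`d_R(σ_f, G) = n - D` iff `f - v` is the annihilator polynomial `∏_{h ∈ H} (X - h)`
of some `D`-dimensional `Fq`-subspace `H` of `⟨g_1, …, g_n⟩`, for some `q`-linearized
`v` of `q`-degree at most `k - 1`. -/
theorem rank_dist_eq_iff
    (q m n k : ℕ) (hq : IsPrimePow q) (hm : 0 < m) (hn : 0 < n) (hnm : n ≤ m)
    (Fq F : Type) [Field Fq] [Fintype Fq] [Field F] [Fintype F] [Algebra Fq F]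
    (hcardFq : Fintype.card Fq = q) (hcardF : Fintype.card F = q ^ m)
    (g : Fin n → F) (hg : LinearIndependent Fq g)
    (hk : 1 ≤ k) (hkn : k ≤ n)
    (D : ℕ) (hkD : k ≤ D) (hDn : D < n)
    (a : ℕ → F) (haD : a D = 1) (htop : ∀ i, D < i → a i = 0)
    (f : Polynomial F) (hf : f = ∑ i ∈ Finset.range (D + 1), C (a i) * X ^ q ^ i)
    (σf : Fin n → F)
    (hσf : σf = fun j => ∑ i ∈ Finset.range (D + 1), a i * g j ^ q ^ i) :
    rankDistTo Fq σf (gabidulinCode q g k) = n - D ↔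
      ∃ H : Submodule Fq F, H ≤ Submodule.span Fq (Set.range g) ∧
        Module.finrank Fq H = D ∧
        ∃ b : ℕ → F, (∀ i, k ≤ i → b i = 0) ∧
          f - (∑ i ∈ Finset.range k, C (b i) * X ^ q ^ i) =
            ∏ h ∈ (H : Set F).toFinset, (X - C h) := by
  subst hcardFq
  have hsum : ∀ {M : Type} [AddCommMonoid M] (b : ℕ → F) (t : ℕ → F → M)
      (_ : ∀ i, t i 0 = 0) (_ : ∀ i, k ≤ i → b i = 0),
      ∑ i ∈ Finset.range k, t i (b i) = ∑ i ∈ Finset.range (D + 1), t i (b i) := by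
    intro M _ b t ht hb
    refine Finset.sum_subset (Finset.range_mono (by omega)) fun i _ hi => ?_
    rw [hb i (by simpa using hi), ht]
  have hpoly : ∀ b : ℕ → F, (∀ i, k ≤ i → b i = 0) →
      f - ∑ i ∈ Finset.range k, C (b i) * X ^ Fintype.card Fq ^ i =
        linearizedPoly Fq (a - b) D := by
    intro b hb
    rw [hsum b (fun i y => C y * X ^ Fintype.card Fq ^ i) (by simp) hb, hf, linearizedPoly,
      ← Finset.sum_sub_distrib]
    simp [sub_mul]
  have hword : ∀ b : ℕ → F, (∀ i, k ≤ i → b i = 0) →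
      (σf - fun j => ∑ i ∈ Finset.range k, b i * g j ^ Fintype.card Fq ^ i) =
        fun j => linearizedMap Fq (a - b) D (g j) := by
    intro b hb
    funext j
    rw [Pi.sub_apply, hsum b (fun i y => y * g j ^ Fintype.card Fq ^ i) (by simp) hb, hσf,
      linearizedMap_apply, ← Finset.sum_sub_distrib]
    simp [sub_mul]
  have hcode : ∀ c, c ∈ gabidulinCode (Fintype.card Fq) g k ↔ ∃ b : ℕ → F,
      (∀ i, k ≤ i → b i = 0) ∧
        c = fun j => ∑ i ∈ Finset.range k, b i * g j ^ Fintype.card Fq ^ i := by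
    intro c
    constructor
    · rintro ⟨v, rfl⟩
      refine ⟨fun i => if h : i < k then v ⟨i, h⟩ else 0, fun i hi => dif_neg hi.not_gt, ?_⟩
      funext j
      rw [← Fin.sum_univ_eq_sum_range
        (fun i => (if h : i < k then v ⟨i, h⟩ else 0) * g j ^ Fintype.card Fq ^ i)]
      simp
    · rintro ⟨b, -, rfl⟩
      exact ⟨fun i => b i, funext fun j =>
        (Fin.sum_univ_eq_sum_range (fun i => b i * g j ^ Fintype.card Fq ^ i) k).symm⟩
  have hlead : ∀ b : ℕ → F, (∀ i, k ≤ i → b i = 0) → (a - b) D = 1 := fun b hb => by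
    simp [haD, hb D hkD]
  rw [rankDistTo_eq_iff_exists (by omega)]
  · constructor
    · rintro ⟨c, hc, hrank⟩
      obtain ⟨b, hb, rfl⟩ := (hcode c).1 hc
      rw [hword b hb] at hrank
      have hadd := finrank_span_range_comp_add_finrank_ker hg (linearizedMap Fq (a - b) D)
      have hD : Module.finrank Fq ↥(Submodule.span Fq (Set.range g) ⊓
          LinearMap.ker (linearizedMap Fq (a - b) D)) = D := by omega
      refine ⟨_, inf_le_left, hD, b, hb, ?_⟩
      rw [hpoly b hb]
      exact (linearizedPoly_eq_prod_iff (hlead b hb) hD).2 inf_le_right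
    · rintro ⟨H, hHg, hD, b, hb, hprod⟩
      rw [hpoly b hb, linearizedPoly_eq_prod_iff (hlead b hb) hD] at hprod
      refine ⟨_, (hcode _).2 ⟨b, hb, rfl⟩, ?_⟩
      rw [hword b hb]
      have hadd := finrank_span_range_comp_add_finrank_ker hg (linearizedMap Fq (a - b) D)
      have hle := finrank_le_of_le_ker (hlead b hb) (inf_le_right :
        Submodule.span Fq (Set.range g) ⊓ LinearMap.ker (linearizedMap Fq (a - b) D) ≤ _)
      have hge := Submodule.finrank_mono (le_inf hHg hprod)
      omega
  · intro c hc
    obtain ⟨b, hb, rfl⟩ := (hcode c).1 hc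
    rw [hword b hb]
    have hadd := finrank_span_range_comp_add_finrank_ker hg (linearizedMap Fq (a - b) D)
    have hle := finrank_le_of_le_ker (hlead b hb) (inf_le_right :
      Submodule.span Fq (Set.range g) ⊓ LinearMap.ker (linearizedMap Fq (a - b) D) ≤ _)
    omega
end

section
/- Let q be a prime power, m, n positive integers with n ≤ m, g_1, …, g_n ∈ F_{q^m} linearly independent over F_q, and 1 ≤ k ≤ n. Let f be a q-linearized polynomial over F_{q^m} with k ≤ deg_q(f) < n and let σ_f = (f(g_1), …, f(g_n)) ∈ F_{q^m}^n. Then d_H(σ_f, G) ≥ n − deg_q(f), where d_H denotes Hamming distance and G is the Gabidulin code of dimension k. -/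
/-- The Hamming distance from a word `u` to a set of words `G`. -/
noncomputable def hammingDistTo {F : Type} [DecidableEq F] {n : ℕ}
    (u : Fin n → F) (G : Set (Fin n → F)) : ℕ :=
  sInf {r : ℕ | ∃ c ∈ G, r = hammingDist u c}

open Polynomial in
/-- The kernel of a nonzero linearized polynomial of `q`-degree `D` has at most `q ^ D` elements. -/
theorem card_ker_linearized_le {F : Type*} [Field F] {q : ℕ} (hq : 1 < q) (D : ℕ) (b : ℕ → F)
    (hb : b D ≠ 0) (s : Finset F)
    (hs : ∀ x ∈ s, ∑ i ∈ Finset.range (D + 1), b i * x ^ q ^ i = 0) :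
    s.card ≤ q ^ D := by
  set P : F[X] := ∑ i ∈ Finset.range (D + 1), C (b i) * X ^ q ^ i with hP
  have hcoeff : P.coeff (q ^ D) = b D := by
    rw [hP, finsetSum_coeff, Finset.sum_eq_single D]
    · simp
    · intro i _ hi
      rw [coeff_C_mul_X_pow, if_neg]
      exact fun h => hi (Nat.pow_right_injective hq h).symm
    · simp
  have hP0 : P ≠ 0 := fun h => hb (by rw [← hcoeff, h, coeff_zero])
  have hdeg : P.natDegree ≤ q ^ D := by
    refine natDegree_sum_le_of_forall_le _ _ fun i hi => ?_
    refine (natDegree_C_mul_X_pow_le _ _).trans (Nat.pow_le_pow_right hq.le ?_)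
    exact Nat.lt_succ_iff.mp (Finset.mem_range.mp hi)
  refine (card_le_degree_of_subset_roots fun x hx => ?_).trans hdeg
  rw [mem_roots hP0, IsRoot.def, hP, eval_finsetSum]
  simpa using hs x hx

/-- A nonzero linearized polynomial of `q`-degree `D` over an extension of a field with `q` elements
vanishes on at most `D` members of a linearly independent family. -/
theorem card_le_of_linearized_eq_zero {Fq F : Type*} [Field Fq] [Fintype Fq] [Field F]
    [Algebra Fq F] {n : ℕ} {g : Fin n → F} (hg : LinearIndependent Fq g) (D : ℕ) (b : ℕ → F)
    (hb : b D ≠ 0) (S : Finset (Fin n))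
    (hS : ∀ j ∈ S, ∑ i ∈ Finset.range (D + 1), b i * g j ^ Fintype.card Fq ^ i = 0) :
    S.card ≤ D := by
  classical
  let L : F →ₗ[Fq] F := ∑ i ∈ Finset.range (D + 1),
    b i • ((FiniteField.frobeniusAlgHom Fq F) ^ i).toLinearMap
  have hL : ∀ x, L x = ∑ i ∈ Finset.range (D + 1), b i * x ^ Fintype.card Fq ^ i := by
    intro x
    simp [L, LinearMap.sum_apply, FiniteField.coe_frobeniusAlgHom, pow_iterate]
  have hgS : LinearIndependent Fq fun j : S => g j := hg.comp _ Subtype.val_injective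
  let T : (S → Fq) → F := fun t => ∑ j, t j • g j
  have hT : Function.Injective T := by
    intro t u h
    exact hgS.fintypeLinearCombination_injective (by
      simpa [T, Fintype.linearCombination_apply] using h)
  have hcard := card_ker_linearized_le (Fintype.one_lt_card (α := Fq)) D b hb
    (Finset.univ.image T) (by
      intro x hx
      obtain ⟨t, -, rfl⟩ := Finset.mem_image.mp hx
      rw [← hL, map_sum]
      refine Finset.sum_eq_zero fun j _ => ?_
      rw [map_smul, hL, hS j j.2, smul_zero])
  rw [Finset.card_image_of_injective _ hT, Finset.card_univ, Fintype.card_fun,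
    Fintype.card_coe] at hcard
  exact (Nat.pow_le_pow_iff_right Fintype.one_lt_card).mp hcard

/-- Theorem 2 (lower bound, Hamming metric): if `f` is a `q`-linearized polynomial with
`k ≤ deg_q f = D < n`, then `d_H(σ_f, G) ≥ n - D`. -/
theorem hamming_dist_lower_bound
    (q m n k : ℕ) (hq : IsPrimePow q) (hm : 0 < m) (hn : 0 < n) (hnm : n ≤ m)
    (Fq F : Type) [Field Fq] [Fintype Fq] [Field F] [Fintype F] [DecidableEq F] [Algebra Fq F]
    (hcardFq : Fintype.card Fq = q) (hcardF : Fintype.card F = q ^ m)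
    (g : Fin n → F) (hg : LinearIndependent Fq g)
    (hk : 1 ≤ k) (hkn : k ≤ n)
    (D : ℕ) (hkD : k ≤ D) (hDn : D < n)
    (a : ℕ → F) (haD : a D ≠ 0) (htop : ∀ i, D < i → a i = 0)
    (σf : Fin n → F)
    (hσf : σf = fun j => ∑ i ∈ Finset.range (D + 1), a i * g j ^ q ^ i) :
    n - D ≤ hammingDistTo σf (gabidulinCode q g k) := by
  subst hcardFq hσf
  refine le_csInf ⟨_, 0, ⟨0, by ext; simp⟩, rfl⟩ ?_
  rintro r ⟨c, ⟨v, rfl⟩, rfl⟩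
  let w : ℕ → F := fun i => if h : i < k then v ⟨i, h⟩ else 0
  have hw : ∀ x : F, ∑ i : Fin k, v i * x ^ Fintype.card Fq ^ (i : ℕ) =
      ∑ i ∈ Finset.range (D + 1), w i * x ^ Fintype.card Fq ^ i := by
    intro x
    rw [← Finset.sum_subset (Finset.range_mono (by omega : k ≤ D + 1)),
      ← Fin.sum_univ_eq_sum_range (fun i => w i * x ^ Fintype.card Fq ^ i)]
    · simp [w]
    · intro i _ hi
      have hik : ¬ i < k := by simpa using hi
      simp [w, hik]
  have hagree := card_le_of_linearized_eq_zero hg D (fun i => a i - w i)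
    (by simpa [w, hkD.not_gt] using haD)
    (Finset.univ.filter fun j => ∑ i ∈ Finset.range (D + 1), a i * g j ^ Fintype.card Fq ^ i =
      ∑ i : Fin k, v i * g j ^ Fintype.card Fq ^ (i : ℕ))
    (by
      intro j hj
      have h := (Finset.mem_filter.mp hj).2
      rw [hw] at h
      simp only [sub_mul, Finset.sum_sub_distrib, h, sub_self])
  have hsplit := Finset.card_filter_add_card_filter_not (s := (Finset.univ : Finset (Fin n)))
    (fun j => ∑ i ∈ Finset.range (D + 1), a i * g j ^ Fintype.card Fq ^ i =
      ∑ i : Fin k, v i * g j ^ Fintype.card Fq ^ (i : ℕ))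
  rw [Finset.card_univ, Fintype.card_fin] at hsplit
  unfold hammingDist
  simp only [ne_eq]
  omega
end

section
/- Let q be a prime power, m, n positive integers with n ≤ m, g_1, …, g_n ∈ F_{q^m} linearly independent over F_q, and 1 ≤ k < n. For every q-linearized polynomial f over F_{q^m} with deg_q(f) = k, the word σ_f = (f(g_1), …, f(g_n)) satisfies d_H(σ_f, G) = n − k, where d_H denotes Hamming distance. -/
open Polynomial in
/-- A linearized polynomial with at most `d` coefficients which vanishes on at least `d`
linearly independent elements is zero. -/
theorem linearized_coeff_eq_zero {K F ι : Type*} [Field K] [Fintype K] [Field F] [Algebra K F]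
    [Fintype ι] {g : ι → F} (hg : LinearIndependent K g) {d : ℕ} (hd : d ≤ Fintype.card ι)
    (b : Fin d → F) (hb : ∀ j, ∑ i, b i * g j ^ Fintype.card K ^ (i : ℕ) = 0) : b = 0 := by
  classical
  set q := Fintype.card K with hq
  have hq1 : 1 < q := Fintype.one_lt_card
  let P : F[X] := ∑ i : Fin d, C (b i) * X ^ q ^ (i : ℕ)
  let φ : F →ₗ[K] F :=
    ∑ i : Fin d, b i • ((FiniteField.frobeniusAlgHom K F) ^ (i : ℕ)).toLinearMap
  have hfrob (i : ℕ) (x : F) : ((FiniteField.frobeniusAlgHom K F) ^ i) x = x ^ q ^ i := by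
    induction i generalizing x with
    | zero => simp
    | succ i ih => rw [pow_succ', AlgHom.mul_apply, ih]; simp [pow_succ, pow_mul, hq]
  have hφ (x : F) : φ x = ∑ i : Fin d, b i * x ^ q ^ (i : ℕ) := by
    simp [φ, LinearMap.sum_apply, hfrob]
  have hP (x : F) : P.eval x = φ x := by
    simp [P, hφ, eval_finsetSum]
  have hdeg : P.natDegree < q ^ d := by
    rcases Nat.eq_zero_or_pos d with rfl | hd0
    · simp [P]
    · refine (natDegree_sum_le_of_forall_le (n := q ^ (d - 1)) _ _ fun i _ => ?_).trans_lt
        (Nat.pow_lt_pow_right hq1 (by omega))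
      exact (natDegree_C_mul_X_pow_le _ _).trans (Nat.pow_le_pow_right hq1.le (by omega))
  have hP0 : P = 0 := by
    refine eq_zero_of_natDegree_lt_card_of_eval_eq_zero P
      (f := fun c : ι → K => Fintype.linearCombination K g c) ?_ ?_ ?_
    · exact LinearIndependent.fintypeLinearCombination_injective hg
    · intro c
      rw [hP, Fintype.linearCombination_apply, map_sum]
      exact Finset.sum_eq_zero fun j _ => by rw [map_smul, hφ, hb, smul_zero]
    · rw [Fintype.card_fun]
      exact hdeg.trans_le (Nat.pow_le_pow_right hq1.le hd)
  ext i
  have h := congrArg (fun p => p.coeff (q ^ (i : ℕ))) hP0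
  simpa [P, finsetSum_coeff, coeff_C_mul, coeff_X_pow, Nat.pow_right_inj hq1, Fin.val_inj] using h

/-- Corollary 1 (Hamming metric): every `σ_f` with `deg_q f = k` is at Hamming distance
exactly `n - k` from the Gabidulin code. -/
theorem hamming_deep_holes_of_qdegree_k
    (q m n k : ℕ) (hq : IsPrimePow q) (hm : 0 < m) (hn : 0 < n) (hnm : n ≤ m)
    (Fq F : Type) [Field Fq] [Fintype Fq] [Field F] [Fintype F] [DecidableEq F] [Algebra Fq F]
    (hcardFq : Fintype.card Fq = q) (hcardF : Fintype.card F = q ^ m)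
    (g : Fin n → F) (hg : LinearIndependent Fq g)
    (hk : 1 ≤ k) (hkn : k < n)
    (a : ℕ → F) (hak : a k ≠ 0) (htop : ∀ i, k < i → a i = 0)
    (σf : Fin n → F)
    (hσf : σf = fun j => ∑ i ∈ Finset.range (k + 1), a i * g j ^ q ^ i) :
    hammingDistTo σf (gabidulinCode q g k) = n - k := by
  subst hcardFq hσf
  set q := Fintype.card Fq
  have hlower : ∀ c ∈ gabidulinCode q g k,
      n - k ≤ hammingDist (fun j => ∑ i ∈ Finset.range (k + 1), a i * g j ^ q ^ i) c := by
    rintro c ⟨v, rfl⟩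
    by_contra! hlt
    let S := Finset.univ.filter fun j : Fin n =>
      ∑ i ∈ Finset.range (k + 1), a i * g j ^ q ^ i = ∑ i : Fin k, v i * g j ^ q ^ (i : ℕ)
    have hS : k + 1 ≤ Fintype.card S := by
      have h := Finset.card_filter_add_card_filter_not (s := (Finset.univ : Finset (Fin n)))
        (fun j => ∑ i ∈ Finset.range (k + 1), a i * g j ^ q ^ i =
          ∑ i : Fin k, v i * g j ^ q ^ (i : ℕ))
      simp only [hammingDist, ne_eq] at hlt
      rw [Finset.card_univ, Fintype.card_fin] at h
      rw [Fintype.card_coe]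
      change k + 1 ≤ Finset.card (Finset.univ.filter _)
      omega
    have h0 := linearized_coeff_eq_zero (hg.comp _ (Subtype.val_injective (p := (· ∈ S)))) hS
      (Fin.snoc (fun i : Fin k => a i - v i) (a k)) (by
        rintro ⟨j, hj⟩
        have hj' := (Finset.mem_filter.mp hj).2
        rw [Finset.sum_range_succ, Finset.sum_range] at hj'
        simp only [Fin.sum_univ_castSucc, Fin.snoc_castSucc, Fin.snoc_last, sub_mul,
          Finset.sum_sub_distrib, Function.comp_apply, Fin.val_castSucc, Fin.val_last]
        linear_combination hj')
    apply hak
    simpa using congrFun h0 (Fin.last k)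
  have hupper : ∃ c ∈ gabidulinCode q g k,
      hammingDist (fun j => ∑ i ∈ Finset.range (k + 1), a i * g j ^ q ^ i) c ≤ n - k := by
    let e : Fin k → Fin n := Fin.castLE hkn.le
    have he : Function.Injective e := Fin.castLE_injective hkn.le
    let T : (Fin k → F) →ₗ[F] (Fin k → F) :=
      Matrix.mulVecLin (Matrix.of fun j i : Fin k => g (e j) ^ q ^ (i : ℕ))
    have hT (v : Fin k → F) (j : Fin k) : T v j = ∑ i, v i * g (e j) ^ q ^ (i : ℕ) := by
      simp [T, Matrix.mulVec, dotProduct, mul_comm]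
    have hinj : Function.Injective T := by
      rw [injective_iff_map_eq_zero]
      intro v hv
      refine linearized_coeff_eq_zero (hg.comp e he) (by simp) v fun j => ?_
      exact (hT v j).symm.trans (congrFun hv j)
    obtain ⟨v, hv⟩ := LinearMap.injective_iff_surjective.mp hinj
      fun j => ∑ i ∈ Finset.range (k + 1), a i * g (e j) ^ q ^ i
    refine ⟨_, ⟨v, rfl⟩, ?_⟩
    have hsub : (Finset.univ.filter fun j : Fin n =>
        ∑ i ∈ Finset.range (k + 1), a i * g j ^ q ^ i ≠ ∑ i : Fin k, v i * g j ^ q ^ (i : ℕ)) ⊆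
        (Finset.univ.map ⟨e, he⟩)ᶜ := by
      intro j hj
      rw [Finset.mem_compl]
      intro hmem
      obtain ⟨i, -, rfl⟩ := Finset.mem_map.mp hmem
      exact (Finset.mem_filter.mp hj).2 ((congrFun hv i).symm.trans (hT v i))
    refine (Finset.card_le_card hsub).trans ?_
    simp [Finset.card_compl]
  obtain ⟨c, hc, hle⟩ := hupper
  unfold hammingDistTo
  apply le_antisymm
  · refine le_trans (Nat.sInf_le ?_) hle
    exact ⟨c, hc, rfl⟩
  · refine le_csInf ⟨_, c, hc, rfl⟩ ?_
    rintro r ⟨c', hc', rfl⟩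
    exact hlower c' hc'
end

section
/- Let q be a prime power, m, n positive integers with n ≤ m, g_1, …, g_n ∈ F_{q^m} linearly independent over F_q, and 1 ≤ k with k + 1 < n. Let f(x) = x^{q^{k+1}} − a_1 x^{q^k} + (terms of q-degree < k) be a monic q-linearized polynomial over F_{q^m} of q-degree k+1, and σ_f = (f(g_1), …, f(g_n)). Then d_H(σ_f, G) = n − (k+1) if and only if there exist k+1 distinct elements g_{i_1}, …, g_{i_{k+1}} among g_1, …, g_n such that a_1 = det(R_k(g_{i_1}, …, g_{i_{k+1}})) / det(M_{k+1}(g_{i_1}, …, g_{i_{k+1}})). -/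
/-- The square Moore matrix `M_N(β_1, …, β_N)`, with `(i, j)` entry `β_j ^ (q ^ i)`. -/
def mooreMatrix (q : ℕ) {F : Type} [Field F] {N : ℕ} (β : Fin N → F) :
    Matrix (Fin N) (Fin N) F :=
  Matrix.of fun i j => β j ^ q ^ (i : ℕ)

/-- The matrix `R_r(β_1, …, β_N)`: the `(N+1) × N` Moore matrix `M_{N+1}(β_1, …, β_N)`
with the row of exponent `q ^ r` deleted. -/
def mooreMatrixDelRow (q r : ℕ) {F : Type} [Field F] {N : ℕ} (β : Fin N → F) :
    Matrix (Fin N) (Fin N) F :=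
  Matrix.of fun i j => β j ^ q ^ (if (i : ℕ) < r then (i : ℕ) else (i : ℕ) + 1)

theorem sum_linearized_eq_zero_of_span {Fq F : Type} [Field Fq] [Fintype Fq] [Field F]
    [Algebra Fq F] {N s : ℕ} (β : Fin N → F) (v : Fin s → F)
    (h : ∀ j, ∑ i, v i * β j ^ Fintype.card Fq ^ (i : ℕ) = 0) (a : Fin N → Fq) :
    ∑ i, v i * (∑ j, a j • β j) ^ Fintype.card Fq ^ (i : ℕ) = 0 := by
  have hpow (i : ℕ) : (∑ j, a j • β j) ^ Fintype.card Fq ^ i =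
      ∑ j, a j • β j ^ Fintype.card Fq ^ i := by
    have hfrob (x : F) : ((FiniteField.frobeniusAlgHom Fq F) ^ i) x =
        x ^ Fintype.card Fq ^ i := by
      rw [AlgHom.coe_pow, FiniteField.coe_frobeniusAlgHom, pow_iterate]
    simp only [← hfrob, map_sum, map_smul]
  simp only [hpow, Finset.mul_sum]
  rw [Finset.sum_comm]
  refine Finset.sum_eq_zero fun j _ => ?_
  simp only [mul_smul_comm, ← Finset.smul_sum, h j, smul_zero]

theorem det_mooreMatrix_ne_zero {Fq F : Type} [Field Fq] [Fintype Fq] [Field F]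
    [Algebra Fq F] {N : ℕ} {β : Fin N → F} (hβ : LinearIndependent Fq β) :
    (mooreMatrix (Fintype.card Fq) β).det ≠ 0 := by
  intro hdet
  obtain ⟨v, hv0, hv⟩ := Matrix.exists_vecMul_eq_zero_iff.mpr hdet
  apply hv0
  have hq : 1 < Fintype.card Fq := Fintype.one_lt_card
  let P : Polynomial F :=
    ∑ i, Polynomial.C (v i) * Polynomial.X ^ Fintype.card Fq ^ (i : ℕ)
  have hP : P = 0 := by
    refine Polynomial.eq_zero_of_natDegree_lt_card_of_eval_eq_zero P
      (f := fun a : Fin N → Fq => ∑ j, a j • β j)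
      hβ.fintypeLinearCombination_injective (fun a => ?_) ?_
    · have := sum_linearized_eq_zero_of_span β v
        (fun j => by simpa [Matrix.vecMul, dotProduct, mooreMatrix] using congrFun hv j) a
      simpa [P, Polynomial.eval_finsetSum] using this
    · rw [Fintype.card_fun, Fintype.card_fin]
      refine lt_of_le_of_lt (Polynomial.natDegree_sum_le_of_forall_le
        (n := Fintype.card Fq ^ N - 1) _ _ fun i _ => ?_)
        (Nat.sub_lt (pow_pos (by omega) _) one_pos)
      exact (Polynomial.natDegree_C_mul_X_pow_le _ _).trans
        (Nat.le_sub_one_of_lt (Nat.pow_lt_pow_right hq i.isLt))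
  funext l
  have hcoeff := congrArg (fun p => Polynomial.coeff p (Fintype.card Fq ^ (l : ℕ))) hP
  simpa [P, Polynomial.finsetSum_coeff, Polynomial.coeff_X_pow, Nat.pow_right_inj hq,
    Fin.val_inj] using hcoeff

theorem det_mooreMatrixDelRow_of_eq_sum {F : Type} [Field F] {q k : ℕ}
    {β : Fin (k + 1) → F} {w : Fin (k + 1) → F}
    (h : ∀ j, β j ^ q ^ (k + 1) = ∑ i, w i * β j ^ q ^ (i : ℕ)) :
    (mooreMatrixDelRow q k β).det = w (Fin.last k) * (mooreMatrix q β).det := by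
  have hrow : mooreMatrixDelRow q k β =
      (mooreMatrix q β).updateRow (Fin.last k) (∑ i, w i • mooreMatrix q β i) := by
    ext i j
    refine Fin.lastCases ?_ (fun i => ?_) i
    · simp [mooreMatrixDelRow, mooreMatrix, h j]
    · simp [mooreMatrixDelRow, mooreMatrix, Matrix.updateRow_apply]
  rw [hrow, Matrix.det_updateRow_sum, smul_eq_mul]

theorem exists_coeffs_of_det_ne_zero {F : Type} [Field F] {q k : ℕ} {β : Fin (k + 1) → F}
    (hβ : (mooreMatrix q β).det ≠ 0) :
    ∃ w : Fin (k + 1) → F, ∀ j, β j ^ q ^ (k + 1) = ∑ i, w i * β j ^ q ^ (i : ℕ) := by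
  obtain ⟨w, hw⟩ := (Matrix.vecMul_surjective_iff_isUnit.mpr
    ((Matrix.isUnit_iff_isUnit_det _).mpr hβ.isUnit)) (fun j => β j ^ q ^ (k + 1))
  refine ⟨w, fun j => ?_⟩
  simpa [Matrix.vecMul, dotProduct, mooreMatrix] using (congrFun hw j).symm

theorem hammingDist_add_card_agree {F : Type} [DecidableEq F] {n : ℕ} (u v : Fin n → F) :
    hammingDist u v + (Finset.univ.filter fun j => u j = v j).card = n := by
  rw [add_comm]
  simpa [hammingDist] using
    Finset.card_filter_add_card_filter_not (s := Finset.univ) (fun j => u j = v j)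

theorem exists_injective_of_le_card {n N : ℕ} {s : Finset (Fin n)} (h : N ≤ s.card) :
    ∃ ι : Fin N → Fin n, Function.Injective ι ∧ ∀ j, ι j ∈ s := by
  obtain ⟨t, hts, htc⟩ := Finset.exists_subset_card_eq h
  exact ⟨t.orderEmbOfFin htc, (t.orderEmbOfFin htc).injective,
    fun j => hts (t.orderEmbOfFin_mem htc j)⟩

theorem not_forall_pow_eq_sum {Fq F : Type} [Field Fq] [Fintype Fq] [Field F]
    [Algebra Fq F] {s : ℕ} {β : Fin (s + 1) → F} (hβ : LinearIndependent Fq β)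
    (w : Fin s → F) :
    ¬ ∀ j, β j ^ Fintype.card Fq ^ s = ∑ i, w i * β j ^ Fintype.card Fq ^ (i : ℕ) := by
  intro h
  refine det_mooreMatrix_ne_zero hβ (Matrix.exists_vecMul_eq_zero_iff.mp
    ⟨Fin.snoc (-w) 1, fun h0 => ?_, ?_⟩)
  · simpa using congrFun h0 (Fin.last s)
  · ext j
    simp [Matrix.vecMul, dotProduct, mooreMatrix, Fin.sum_univ_castSucc, h j]

/-- Lemma 4: for `f(x) = x^{q^{k+1}} - a₁ x^{q^k} + (q-degree < k terms)`,
`σ_f` is not a deep hole in the Hamming metric, i.e. `d_H(σ_f, G) = n - (k+1)`, iff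
there are `k+1` distinct elements `g_{i_1}, …, g_{i_{k+1}}` among `g_1, …, g_n` with
`a₁ = det R_k(g_{i_·}) / det M_{k+1}(g_{i_·})`. -/
theorem hamming_not_deep_hole_iff_deg_k_add_one
    (q m n k : ℕ) (hq : IsPrimePow q) (hm : 0 < m) (hn : 0 < n) (hnm : n ≤ m)
    (Fq F : Type) [Field Fq] [Fintype Fq] [Field F] [Fintype F] [DecidableEq F] [Algebra Fq F]
    (hcardFq : Fintype.card Fq = q) (hcardF : Fintype.card F = q ^ m)
    (g : Fin n → F) (hg : LinearIndependent Fq g)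
    (hk : 1 ≤ k) (hkn : k + 1 < n)
    (a₁ : F) (c : Fin k → F)
    (σf : Fin n → F)
    (hσf : σf = fun j =>
      g j ^ q ^ (k + 1) - a₁ * g j ^ q ^ k + ∑ i : Fin k, c i * g j ^ q ^ (i : ℕ)) :
    hammingDistTo σf (gabidulinCode q g k) = n - (k + 1) ↔
      ∃ ι : Fin (k + 1) → Fin n, Function.Injective ι ∧
        a₁ = (mooreMatrixDelRow q k (g ∘ ι)).det / (mooreMatrix q (g ∘ ι)).det := by
  subst hcardFq hσf
  set q := Fintype.card Fq
  set σ : Fin n → F := fun j =>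
    g j ^ q ^ (k + 1) - a₁ * g j ^ q ^ k + ∑ i : Fin k, c i * g j ^ q ^ (i : ℕ) with hσ
  have hagree (v : Fin k → F) (j : Fin n) :
      σ j = ∑ i : Fin k, v i * g j ^ q ^ (i : ℕ) ↔
        g j ^ q ^ (k + 1) =
          ∑ i, (Fin.snoc (v - c) a₁ : Fin (k + 1) → F) i * g j ^ q ^ (i : ℕ) := by
    simp only [hσ, Fin.sum_univ_castSucc, Fin.snoc_castSucc, Fin.snoc_last, Pi.sub_apply,
      sub_mul, Finset.sum_sub_distrib, Fin.val_castSucc, Fin.val_last]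
    constructor <;> intro h <;> linear_combination h
  have hlower : ∀ u ∈ gabidulinCode q g k, n - (k + 1) ≤ hammingDist σ u := by
    rintro _ ⟨v, rfl⟩
    by_contra! hlt
    have hcard := hammingDist_add_card_agree σ fun j => ∑ i : Fin k, v i * g j ^ q ^ (i : ℕ)
    obtain ⟨ι, hι, hmem⟩ := exists_injective_of_le_card (N := k + 2)
      (s := Finset.univ.filter fun j => σ j = ∑ i : Fin k, v i * g j ^ q ^ (i : ℕ)) (by omega)
    exact not_forall_pow_eq_sum (hg.comp ι hι) _ fun j =>
      (hagree v (ι j)).mp (Finset.mem_filter.mp (hmem j)).2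
  constructor
  · intro h
    have hne : {r : ℕ | ∃ u ∈ gabidulinCode q g k, r = hammingDist σ u}.Nonempty :=
      ⟨_, _, ⟨0, rfl⟩, rfl⟩
    obtain ⟨_, ⟨v, rfl⟩, hv⟩ := Nat.sInf_mem hne
    change hammingDistTo σ (gabidulinCode q g k) = _ at hv
    have hcard := hammingDist_add_card_agree σ fun j => ∑ i : Fin k, v i * g j ^ q ^ (i : ℕ)
    obtain ⟨ι, hι, hmem⟩ := exists_injective_of_le_card (N := k + 1)
      (s := Finset.univ.filter fun j => σ j = ∑ i : Fin k, v i * g j ^ q ^ (i : ℕ)) (by omega)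
    refine ⟨ι, hι, ?_⟩
    rw [eq_div_iff (det_mooreMatrix_ne_zero (hg.comp ι hι)),
      det_mooreMatrixDelRow_of_eq_sum (β := g ∘ ι) fun j =>
        (hagree v (ι j)).mp (Finset.mem_filter.mp (hmem j)).2, Fin.snoc_last]
  · rintro ⟨ι, hι, ha⟩
    have hdet := det_mooreMatrix_ne_zero (hg.comp ι hι)
    obtain ⟨w, hw⟩ := exists_coeffs_of_det_ne_zero hdet
    rw [det_mooreMatrixDelRow_of_eq_sum hw, mul_div_cancel_right₀ _ hdet] at ha
    let v : Fin k → F := Fin.init w + c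
    have hsnoc : (Fin.snoc (v - c) a₁ : Fin (k + 1) → F) = w := by
      rw [ha, show v - c = Fin.init w by simp [v], Fin.snoc_init_self]
    let u : Fin n → F := fun j => ∑ i : Fin k, v i * g j ^ q ^ (i : ℕ)
    have hu : u ∈ gabidulinCode q g k := ⟨v, rfl⟩
    have hle : k + 1 ≤ (Finset.univ.filter fun j => σ j = u j).card := by
      have hsub : Finset.univ.image ι ⊆ Finset.univ.filter fun j => σ j = u j := by
        intro x hx
        obtain ⟨j, -, rfl⟩ := Finset.mem_image.mp hx
        exact Finset.mem_filter.mpr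
          ⟨Finset.mem_univ _, (hagree v (ι j)).mpr (by rw [hsnoc]; exact hw j)⟩
      simpa [Finset.card_image_of_injective _ hι] using Finset.card_le_card hsub
    have hcard := hammingDist_add_card_agree σ u
    apply le_antisymm
    · have hmin : hammingDistTo σ (gabidulinCode q g k) ≤ hammingDist σ u :=
        Nat.sInf_le ⟨u, hu, rfl⟩
      omega
    · refine le_csInf ⟨_, u, hu, rfl⟩ ?_
      rintro _ ⟨u', hu', rfl⟩
      exact hlower u' hu'
end

section
/- Let q be a prime power, m, n positive integers with n ≤ m, g_1, …, g_n ∈ F_{q^m} linearly independent over F_q, and k, d ≥ 1 with k + d < n. Let f(x) = x^{q^{k+d}} − a_1 x^{q^{k+d−1}} + a_2 x^{q^{k+d−2}} + ⋯ + (−1)^d a_d x^{q^k} + (terms of q-degree < k) be a monic q-linearized polynomial over F_{q^m} of q-degree k+d, and σ_f = (f(g_1), …, f(g_n)). Then d_H(σ_f, G) = n − (k+d) if and only if there exist k+d distinct elements g_{i_1}, …, g_{i_{k+d}} among g_1, …, g_n such that for all 1 ≤ i ≤ d, a_i = det(R_{k+d−i}(g_{i_1}, …, g_{i_{k+d}}))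 / det(M_{k+d}(g_{i_1}, …, g_{i_{k+d}})). -/
/-- A `q`-linearized polynomial of `q`-degree less than `N` that vanishes at `N` points linearly
independent over `F_q` is zero. -/
theorem linearized_coeff_eq_zero_s11 {Fq F : Type} [Field Fq] [Fintype Fq] [Field F] [Algebra Fq F]
    {q N : ℕ} (hq : Fintype.card Fq = q) {x : Fin N → F} (hx : LinearIndependent Fq x)
    {v : Fin N → F} (hv : ∀ j, ∑ i, v i * x j ^ q ^ (i : ℕ) = 0) : v = 0 := by
  classical
  have hq1 : 1 < q := hq ▸ Fintype.one_lt_card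
  let φ : F →ₗ[Fq] F :=
    ∑ i : Fin N, v i • ((FiniteField.frobeniusAlgHom Fq F) ^ (i : ℕ)).toLinearMap
  have hφ : ∀ y, φ y = ∑ i, v i * y ^ q ^ (i : ℕ) := by
    intro y
    simp [φ, LinearMap.sum_apply, AlgHom.coe_pow, FiniteField.coe_frobeniusAlgHom, pow_iterate, hq]
  let p : Polynomial F := ∑ i, Polynomial.C (v i) * Polynomial.X ^ q ^ (i : ℕ)
  have hp : ∀ y, p.eval y = φ y := by
    intro y
    simp [p, hφ, Polynomial.eval_finsetSum]
  have hp0 : p = 0 := by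
    refine Polynomial.eq_zero_of_natDegree_lt_card_of_eval_eq_zero p
      (f := fun s : Fin N → Fq => ∑ j, s j • x j) ?_ ?_ ?_
    · exact hx.fintypeLinearCombination_injective
    · intro s
      rw [hp, map_sum]
      refine Finset.sum_eq_zero fun j _ => ?_
      rw [map_smul, hφ, hv, smul_zero]
    · rw [Fintype.card_fun, Fintype.card_fin, hq]
      rcases Nat.eq_zero_or_pos N with rfl | hN
      · simp [p]
      · refine lt_of_le_of_lt (b := q ^ (N - 1)) ?_ (Nat.pow_lt_pow_right hq1 (by omega))
        refine Polynomial.natDegree_sum_le_of_forall_le _ _ fun i _ => ?_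
        exact (Polynomial.natDegree_C_mul_X_pow_le _ _).trans
          (Nat.pow_le_pow_right (by omega) (by omega))
  funext i
  have := congrArg (fun r => Polynomial.coeff r (q ^ (i : ℕ))) hp0
  simpa [p, Polynomial.finsetSum_coeff, Polynomial.coeff_C_mul, Polynomial.coeff_X_pow,
    Nat.pow_right_inj hq1, Fin.val_inj] using this

theorem mooreMatrix_det_ne_zero {Fq F : Type} [Field Fq] [Fintype Fq] [Field F] [Algebra Fq F]
    {q N : ℕ} (hq : Fintype.card Fq = q) {x : Fin N → F} (hx : LinearIndependent Fq x) :
    (mooreMatrix q x).det ≠ 0 := by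
  intro h
  obtain ⟨v, hv, h0⟩ := Matrix.exists_vecMul_eq_zero_iff.mpr h
  exact hv (linearized_coeff_eq_zero_s11 hq hx fun j => congrFun h0 j)

/-- Laplace expansion of a Moore determinant of order `N + 1` with a repeated column. -/
theorem moore_expansion (q : ℕ) {F : Type} [Field F] {N : ℕ} (x : Fin N → F) (j : Fin N) :
    (mooreMatrix q x).det * x j ^ q ^ N +
      ∑ r : Fin N, (-1) ^ ((r : ℕ) + N) * (mooreMatrixDelRow q r x).det * x j ^ q ^ (r : ℕ)
        = 0 := by
  let A : Matrix (Fin (N + 1)) (Fin (N + 1)) F := mooreMatrix q (Fin.snoc x (x j) : Fin (N + 1) → F)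
  have hA : A.det = 0 := by
    refine Matrix.det_zero_of_column_eq (i := j.castSucc) (j := Fin.last N)
      (Fin.castSucc_lt_last j).ne fun i => ?_
    simp [A, mooreMatrix]
  have hsub : ∀ r : Fin (N + 1),
      A.submatrix r.succAbove (Fin.last N).succAbove = mooreMatrixDelRow q r x := by
    intro r
    ext i s
    simp only [A, mooreMatrix, mooreMatrixDelRow, Matrix.submatrix_apply, Matrix.of_apply,
      Fin.succAbove_last, Fin.snoc_castSucc, Fin.succAbove, Fin.lt_def, Fin.val_castSucc]
    split_ifs <;> simp
  have hlast : mooreMatrixDelRow q N x = mooreMatrix q x := by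
    ext i s
    simp [mooreMatrix, mooreMatrixDelRow]
  rw [Matrix.det_succ_column A (Fin.last N), Fin.sum_univ_castSucc] at hA
  simp only [hsub, Fin.val_last, Fin.val_castSucc, hlast] at hA
  simp only [A, mooreMatrix, Matrix.of_apply, Fin.snoc_last, Fin.val_last, Fin.val_castSucc,
    Even.neg_one_pow (Even.add_self N), one_mul] at hA
  rw [add_comm, ← hA]
  congr 1
  · exact Finset.sum_congr rfl fun r _ => by ring
  · exact mul_comm _ _

/-- The monic `q`-linearized polynomial of `q`-degree `N` with lower coefficients `w` vanishes at
the independent points `x` iff its coefficients are the normalized maximal minors of the Moore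
matrix. -/
theorem monic_linearized_vanishes_iff {Fq F : Type} [Field Fq] [Fintype Fq] [Field F]
    [Algebra Fq F] {q N : ℕ} (hq : Fintype.card Fq = q) {x : Fin N → F}
    (hx : LinearIndependent Fq x) (w : Fin N → F) :
    (∀ j, x j ^ q ^ N + ∑ r, w r * x j ^ q ^ (r : ℕ) = 0) ↔
      ∀ r : Fin N, w r =
        (-1) ^ ((r : ℕ) + N) * ((mooreMatrixDelRow q r x).det / (mooreMatrix q x).det) := by
  have hM := mooreMatrix_det_ne_zero hq hx
  have hsol : ∀ j, x j ^ q ^ N + ∑ r : Fin N, ((-1) ^ ((r : ℕ) + N) *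
      ((mooreMatrixDelRow q r x).det / (mooreMatrix q x).det)) * x j ^ q ^ (r : ℕ) = 0 := by
    intro j
    apply mul_left_cancel₀ hM
    rw [mul_zero, ← moore_expansion q x j, mul_add, Finset.mul_sum]
    congr 1
    refine Finset.sum_congr rfl fun r _ => ?_
    field_simp
  constructor
  · intro h
    refine fun r => sub_eq_zero.mp (congrFun (linearized_coeff_eq_zero_s11 hq hx (v := fun r => w r -
      (-1) ^ ((r : ℕ) + N) * ((mooreMatrixDelRow q r x).det / (mooreMatrix q x).det)) ?_) r)
    intro j
    simp only [sub_mul, Finset.sum_sub_distrib]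
    rw [sub_eq_zero]
    exact add_left_cancel ((h j).trans (hsol j).symm)
  · intro h j
    simpa only [← h] using hsol j

/-- A monic `q`-linearized polynomial of `q`-degree `N` has at most `N` roots in a family that is
linearly independent over `F_q`. -/
theorem card_zeros_monic_linearized_le {Fq F : Type} [Field Fq] [Fintype Fq] [Field F]
    [Algebra Fq F] {q N n : ℕ} (hq : Fintype.card Fq = q) {g : Fin n → F}
    (hg : LinearIndependent Fq g) (w : Fin N → F) (Z : Finset (Fin n))
    (hZ : ∀ j ∈ Z, g j ^ q ^ N + ∑ r, w r * g j ^ q ^ (r : ℕ) = 0) : Z.card ≤ N := by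
  by_contra! h
  obtain ⟨Y, hYZ, hY⟩ := Finset.exists_subset_card_eq (Nat.succ_le_of_lt h)
  have := linearized_coeff_eq_zero_s11 hq (hg.comp _ (Y.orderEmbOfFin hY).injective)
    (v := (Fin.snoc w 1 : Fin (N + 1) → F)) fun j => by
      rw [Fin.sum_univ_castSucc, add_comm]
      simpa using hZ _ (hYZ (Y.orderEmbOfFin_mem hY j))
  simpa using congrFun this (Fin.last N)

theorem hammingDist_eq_sub_card {α : Type} [DecidableEq α] {n : ℕ} (u v : Fin n → α) :
    hammingDist u v = n - (Finset.univ.filter fun j => u j = v j).card := by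
  have h := Finset.card_filter_add_card_filter_not (s := (Finset.univ : Finset (Fin n)))
    (fun j => u j = v j)
  rw [Finset.card_univ, Fintype.card_fin] at h
  unfold hammingDist
  simp only [ne_eq]
  omega

theorem sum_Icc_eq_sum_fin_reflect {M : Type} [AddCommMonoid M] (d : ℕ) (f : ℕ → M) :
    ∑ i ∈ Finset.Icc 1 d, f i = ∑ s : Fin d, f (d - s) := by
  rw [Fin.sum_univ_eq_sum_range (fun s => f (d - s))]
  refine Finset.sum_bij' (fun i _ => d - i) (fun i _ => d - i) ?_ ?_ ?_ ?_ ?_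
  all_goals
    intro i hi
    simp only [Finset.mem_Icc, Finset.mem_range] at hi ⊢
  · omega
  · omega
  · omega
  · omega
  · congr 1; omega

/-- For `f(x) = x^{q^{k+d}} - a₁ x^{q^{k+d-1}} + ⋯ + (-1)^d a_d x^{q^k} + (q-degree < k
terms)`, one has `d_H(σ_f, G) = n - (k+d)` iff there are `k+d` distinct elements
`g_{i_1}, …, g_{i_{k+d}}` among `g_1, …, g_n` with
`a_i = det R_{k+d-i}(g_{i_·}) / det M_{k+d}(g_{i_·})` for all `1 ≤ i ≤ d`. -/
theorem hamming_dist_eq_iff_deg_k_add_d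
    (q m n k d : ℕ) (hq : IsPrimePow q) (hm : 0 < m) (hn : 0 < n) (hnm : n ≤ m)
    (Fq F : Type) [Field Fq] [Fintype Fq] [Field F] [Fintype F] [DecidableEq F] [Algebra Fq F]
    (hcardFq : Fintype.card Fq = q) (hcardF : Fintype.card F = q ^ m)
    (g : Fin n → F) (hg : LinearIndependent Fq g)
    (hk : 1 ≤ k) (hd : 1 ≤ d) (hkdn : k + d < n)
    (a : ℕ → F) (c : Fin k → F)
    (σf : Fin n → F)
    (hσf : σf = fun j =>
      g j ^ q ^ (k + d) + (∑ i ∈ Finset.Icc 1 d, (-1 : F) ^ i * a i * g j ^ q ^ (k + d - i))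
        + ∑ i : Fin k, c i * g j ^ q ^ (i : ℕ)) :
    hammingDistTo σf (gabidulinCode q g k) = n - (k + d) ↔
      ∃ ι : Fin (k + d) → Fin n, Function.Injective ι ∧
        ∀ i ∈ Finset.Icc 1 d,
          a i = (mooreMatrixDelRow q (k + d - i) (g ∘ ι)).det /
            (mooreMatrix q (g ∘ ι)).det := by
  subst hσf
  let b : (Fin k → F) → Fin (k + d) → F := fun v =>
    Fin.append (fun i => c i - v i) (fun s : Fin d => (-1) ^ (d - (s : ℕ)) * a (d - s))
  let σ : Fin n → F := fun j =>
    g j ^ q ^ (k + d) + (∑ i ∈ Finset.Icc 1 d, (-1 : F) ^ i * a i * g j ^ q ^ (k + d - i))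
      + ∑ i : Fin k, c i * g j ^ q ^ (i : ℕ)
  change hammingDistTo σ (gabidulinCode q g k) = n - (k + d) ↔ _
  have hσ : ∀ v j, σ j = ∑ i : Fin k, v i * g j ^ q ^ (i : ℕ) ↔
      g j ^ q ^ (k + d) + ∑ r, b v r * g j ^ q ^ (r : ℕ) = 0 := by
    intro v j
    rw [← sub_eq_zero]
    suffices h : σ j - ∑ i : Fin k, v i * g j ^ q ^ (i : ℕ) =
        g j ^ q ^ (k + d) + ∑ r, b v r * g j ^ q ^ (r : ℕ) by rw [h]
    simp only [σ, b, Fin.sum_univ_add, Fin.append_left, Fin.append_right, Fin.val_castAdd,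
      Fin.val_natAdd, sub_mul, Finset.sum_sub_distrib, sum_Icc_eq_sum_fin_reflect]
    have hexp : ∀ s : Fin d, k + d - (d - (s : ℕ)) = k + s := fun s => by omega
    simp only [hexp]
    ring
  let Z : (Fin k → F) → Finset (Fin n) := fun v =>
    Finset.univ.filter fun j => σ j = ∑ i : Fin k, v i * g j ^ q ^ (i : ℕ)
  have hZ : ∀ v, (Z v).card ≤ k + d := fun v =>
    card_zeros_monic_linearized_le hcardFq hg (b v) (Z v) fun j hj =>
      (hσ v j).mp (Finset.mem_filter.mp hj).2
  have hdist : ∀ v, hammingDist σ (fun j => ∑ i : Fin k, v i * g j ^ q ^ (i : ℕ)) =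
      n - (Z v).card := fun v => hammingDist_eq_sub_card _ _
  have hmin : hammingDistTo σ (gabidulinCode q g k) = n - (k + d) ↔
      ∃ v, k + d ≤ (Z v).card := by
    constructor
    · intro h
      obtain ⟨_, ⟨v, rfl⟩, h'⟩ := Nat.sInf_mem
        (s := {r | ∃ c ∈ gabidulinCode q g k, r = hammingDist σ c}) ⟨_, _, ⟨0, rfl⟩, rfl⟩
      refine ⟨v, ?_⟩
      have h'' := h.symm.trans h'
      rw [hdist] at h''
      omega
    · rintro ⟨v, hv⟩
      refine le_antisymm (Nat.sInf_le ⟨_, ⟨v, rfl⟩, ?_⟩) (le_csInf ⟨_, _, ⟨0, rfl⟩, rfl⟩ ?_)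
      · rw [hdist, le_antisymm (hZ v) hv]
      · rintro _ ⟨_, ⟨v, rfl⟩, rfl⟩
        rw [hdist]
        exact Nat.sub_le_sub_left (hZ v) n
  rw [hmin]
  constructor
  · rintro ⟨v, hv⟩
    have hc := le_antisymm (hZ v) hv
    let ι := (Z v).orderEmbOfFin hc
    refine ⟨ι, ι.injective, fun i hi => ?_⟩
    rw [Finset.mem_Icc] at hi
    have h := (monic_linearized_vanishes_iff hcardFq (hg.comp ι ι.injective) (b v)).mp
      (fun j => (hσ v (ι j)).mp (Finset.mem_filter.mp ((Z v).orderEmbOfFin_mem hc j)).2)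
      (Fin.natAdd k ⟨d - i, by omega⟩)
    simp only [b, Fin.append_right, Fin.val_natAdd] at h
    rw [show d - (d - i) = i by omega, show k + (d - i) = k + d - i by omega,
      show k + d - i + (k + d) = 2 * (k + d - i) + i by omega, pow_add, pow_mul] at h
    exact mul_left_cancel₀ (pow_ne_zero i (neg_ne_zero.mpr one_ne_zero)) (by simpa using h)
  · rintro ⟨ι, hι, ha⟩
    let w : Fin (k + d) → F := fun r => (-1) ^ ((r : ℕ) + (k + d)) *
      ((mooreMatrixDelRow q r (g ∘ ι)).det / (mooreMatrix q (g ∘ ι)).det)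
    let v : Fin k → F := fun i => c i - w (Fin.castAdd d i)
    have hw : ∀ r, b v r = w r := by
      intro r
      refine Fin.addCases (fun i => ?_) (fun s => ?_) r
      · simp [b, v]
      · simp only [b, w, Fin.append_right, Fin.val_natAdd]
        rw [ha (d - s) (Finset.mem_Icc.mpr (by omega)),
          show k + d - (d - (s : ℕ)) = k + s by omega,
          show k + (s : ℕ) + (k + d) = 2 * (k + s) + (d - s) by omega, pow_add, pow_mul]
        simp
    have h := (monic_linearized_vanishes_iff hcardFq (hg.comp ι hι) (b v)).mpr hw
    refine ⟨v, ?_⟩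
    have hsub : Finset.univ.image ι ⊆ Z v := by
      intro j hj
      obtain ⟨i, -, rfl⟩ := Finset.mem_image.mp hj
      exact Finset.mem_filter.mpr ⟨Finset.mem_univ _, (hσ v _).mpr (h i)⟩
    simpa [Finset.card_image_of_injective _ hι] using Finset.card_le_card hsub
end

section
/- Let q be a prime power, m an odd positive integer, 3 ≤ n ≤ m, g_1, …, g_n ∈ F_{q^m} linearly independent over F_q, and k = 1. Let f(x) = x^{q^2} + c x with c ∈ F_{q^m}, and σ_f = (f(g_1), …, f(g_n)). Then d_R(σ_f, G) = n − 1, i.e., σ_f is a deep hole of the Gabidulin code G of dimension 1. -/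
open Polynomial in
theorem FiniteField.exists_algebraMap_eq_of_pow_card_eq_self {K L : Type*} [Field K] [Fintype K]
    [Field L] [Algebra K L] {z : L} (hz : z ^ Fintype.card K = z) :
    ∃ a : K, algebraMap K L a = z := by
  have hcard := Fintype.one_lt_card (α := K)
  have hsplit := prod_multiset_X_sub_C_of_monic_of_roots_card_eq
    (p := (X ^ Fintype.card K - X : K[X]))
    (monic_X_pow_sub (by simpa using hcard))
    (by rw [roots_X_pow_card_sub_X, X_pow_card_sub_X_natDegree_eq K hcard]; rfl)
  rw [roots_X_pow_card_sub_X] at hsplit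
  have h : aeval z (∏ a : K, (X - C a)) = 0 := by
    rw [Finset.prod, hsplit]
    simp [hz]
  rw [map_prod, Finset.prod_eq_zero_iff] at h
  obtain ⟨a, -, ha⟩ := h
  exact ⟨a, (sub_eq_zero.mp (by simpa using ha)).symm⟩

theorem FiniteField.pow_card_eq_self_of_odd {L : Type*} [Field L] [Fintype L] {q m : ℕ}
    (hm : Odd m) (hcard : Fintype.card L = q ^ m) {z : L} (hz : z ^ q ^ 2 = z) : z ^ q = z := by
  obtain ⟨k, rfl⟩ := hm
  have hiter : ∀ j : ℕ, z ^ q ^ (2 * j) = z := by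
    intro j
    induction j with
    | zero => simp
    | succ j ih => rw [mul_add_one, pow_add, pow_mul, ih, hz]
  calc z ^ q = (z ^ q ^ (2 * k)) ^ q := by rw [hiter]
    _ = z ^ q ^ (2 * k + 1) := by rw [← pow_mul, ← pow_succ]
    _ = z := by rw [← hcard, FiniteField.pow_card]

/-- The map `x ↦ x ^ q ^ 2 + b * x`, where `q` is the cardinality of `K`. -/
def FiniteField.frobeniusSqAddMul (K : Type*) {L : Type*} [Field K] [Fintype K] [Field L]
    [Algebra K L] (b : L) : L →ₗ[K] L :=
  (frobeniusAlgHom K L ^ 2).toLinearMap + LinearMap.mulLeft K b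

theorem FiniteField.frobeniusSqAddMul_apply (K : Type*) {L : Type*} [Field K] [Fintype K]
    [Field L] [Algebra K L] (b x : L) :
    frobeniusSqAddMul K b x = x ^ Fintype.card K ^ 2 + b * x := by
  simp [frobeniusSqAddMul, pow_two, pow_mul]

theorem FiniteField.finrank_ker_frobeniusSqAddMul_le_one {K L : Type*} [Field K] [Fintype K]
    [Field L] [Fintype L] [Algebra K L] {m : ℕ} (hm : Odd m)
    (hcard : Fintype.card L = Fintype.card K ^ m) (b : L) :
    Module.finrank K (LinearMap.ker (frobeniusSqAddMul K b)) ≤ 1 := by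
  by_cases h : ∃ v : LinearMap.ker (frobeniusSqAddMul K b), v ≠ 0
  · obtain ⟨v, hv⟩ := h
    have hv0 : (v : L) ≠ 0 := by simpa using hv
    refine finrank_le_one v fun w => ?_
    have hvk := v.2
    have hwk := w.2
    rw [LinearMap.mem_ker, frobeniusSqAddMul_apply] at hvk hwk
    have hz : ((w : L) / v) ^ Fintype.card K ^ 2 = w / v := by
      have hvp : (v : L) ^ Fintype.card K ^ 2 ≠ 0 := pow_ne_zero _ hv0
      rw [div_pow, div_eq_div_iff hvp hv0]
      linear_combination (v : L) * hwk - (w : L) * hvk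
    obtain ⟨a, ha⟩ := exists_algebraMap_eq_of_pow_card_eq_self
      (pow_card_eq_self_of_odd hm hcard hz)
    refine ⟨a, Subtype.ext ?_⟩
    rw [Submodule.coe_smul, Algebra.smul_def, ha, div_mul_cancel₀ _ hv0]
  · push Not at h
    exact finrank_le_one 0 fun w => ⟨0, by rw [h w, smul_zero]⟩

/-- Rank-nullity for the restriction of `f` to the span of a linearly independent family. -/
theorem LinearIndependent.finrank_span_comp_add_finrank_ker {K V W ι : Type*} [Field K]
    [AddCommGroup V] [Module K V] [AddCommGroup W] [Module K W] [Fintype ι] {g : ι → V}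
    (hg : LinearIndependent K g) (f : V →ₗ[K] W) :
    Module.finrank K (Submodule.span K (Set.range (f ∘ g))) +
      Module.finrank K (LinearMap.ker (f.domRestrict (Submodule.span K (Set.range g)))) =
      Fintype.card ι := by
  have := FiniteDimensional.span_of_finite K (Set.finite_range g)
  rw [Set.range_comp, Submodule.span_image, ← LinearMap.range_domRestrict,
    LinearMap.finrank_range_add_finrank_ker, finrank_span_eq_card hg]

theorem LinearMap.finrank_ker_domRestrict_le {K V W : Type*} [Field K]
    [AddCommGroup V] [Module K V] [FiniteDimensional K V] [AddCommGroup W] [Module K W]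
    (f : V →ₗ[K] W) (S : Submodule K V) :
    Module.finrank K (LinearMap.ker (f.domRestrict S)) ≤ Module.finrank K (LinearMap.ker f) :=
  LinearMap.finrank_le_finrank_of_injective
    (f := S.subtype.restrict (p := LinearMap.ker (f.domRestrict S)) (q := LinearMap.ker f)
      fun _ hx => hx)
    fun _ _ h => Subtype.ext (Subtype.ext (Subtype.ext_iff.mp h :))

/-- Proposition 6: let `m` be odd, `3 ≤ n ≤ m` and `k = 1`. Then for
`f(x) = x^{q^2} + c x`, the word `σ_f` is a deep hole of the Gabidulin code of
dimension `1`, i.e. `d_R(σ_f, G) = n - 1`. -/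
theorem deep_hole_dimension_one_odd_m
    (q m n : ℕ) (hq : IsPrimePow q) (hm : Odd m) (hn : 3 ≤ n) (hnm : n ≤ m)
    (Fq F : Type) [Field Fq] [Fintype Fq] [Field F] [Fintype F] [Algebra Fq F]
    (hcardFq : Fintype.card Fq = q) (hcardF : Fintype.card F = q ^ m)
    (g : Fin n → F) (hg : LinearIndependent Fq g)
    (c : F)
    (σf : Fin n → F)
    (hσf : σf = fun j => g j ^ q ^ 2 + c * g j) :
    rankDistTo Fq σf (gabidulinCode q g 1) = n - 1 := by
  subst hcardFq hσf
  have hdiff : ∀ v : Fin 1 → F,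
      ((fun j => g j ^ Fintype.card Fq ^ 2 + c * g j) -
        fun j => ∑ i : Fin 1, v i * g j ^ Fintype.card Fq ^ (i : ℕ)) =
      FiniteField.frobeniusSqAddMul Fq (c - v 0) ∘ g := by
    intro v
    ext j
    simp only [Pi.sub_apply, Fin.sum_univ_one, Fin.val_zero, pow_zero, pow_one,
      Function.comp_apply, FiniteField.frobeniusSqAddMul_apply]
    ring
  let j₀ : Fin n := ⟨0, by omega⟩
  have hg₀ : g j₀ ≠ 0 := hg.ne_zero j₀
  have hlower : ∀ b : F,
      n - 1 ≤ Module.finrank Fq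
        (Submodule.span Fq (Set.range (FiniteField.frobeniusSqAddMul Fq b ∘ g))) := by
    intro b
    have hrank := hg.finrank_span_comp_add_finrank_ker (FiniteField.frobeniusSqAddMul Fq b)
    have hker := (LinearMap.finrank_ker_domRestrict_le (FiniteField.frobeniusSqAddMul Fq b)
      (Submodule.span Fq (Set.range g))).trans
      (FiniteField.finrank_ker_frobeniusSqAddMul_le_one hm hcardF b)
    rw [Fintype.card_fin] at hrank
    omega
  let a : F := c + g j₀ ^ Fintype.card Fq ^ 2 / g j₀
  have hupper : Module.finrank Fq
      (Submodule.span Fq (Set.range (FiniteField.frobeniusSqAddMul Fq (c - a) ∘ g))) ≤ n - 1 := by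
    have hrank := hg.finrank_span_comp_add_finrank_ker (FiniteField.frobeniusSqAddMul Fq (c - a))
    have hker : 0 < Module.finrank Fq (LinearMap.ker
        ((FiniteField.frobeniusSqAddMul Fq (c - a)).domRestrict
          (Submodule.span Fq (Set.range g)))) := by
      have := FiniteDimensional.span_of_finite Fq (Set.finite_range g)
      rw [Nat.pos_iff_ne_zero, Ne, Submodule.finrank_eq_zero, ← Ne, Submodule.ne_bot_iff]
      refine ⟨⟨g j₀, Submodule.subset_span ⟨j₀, rfl⟩⟩, ?_, ?_⟩
      · rw [LinearMap.mem_ker, LinearMap.domRestrict_apply, FiniteField.frobeniusSqAddMul_apply]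
        simp only [a]
        field_simp
        ring
      · simpa [Subtype.ext_iff] using hg₀
    rw [Fintype.card_fin] at hrank
    omega
  have hmem : ∀ v : Fin 1 → F,
      Module.finrank Fq (Submodule.span Fq
        (Set.range (FiniteField.frobeniusSqAddMul Fq (c - v 0) ∘ g))) ∈
      {r : ℕ | ∃ w ∈ gabidulinCode (Fintype.card Fq) g 1, r = Module.finrank Fq
        (Submodule.span Fq (Set.range
          ((fun j => g j ^ Fintype.card Fq ^ 2 + c * g j) - w)))} :=
    fun v => ⟨_, ⟨v, rfl⟩, by rw [hdiff v]⟩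
  refine le_antisymm ((Nat.sInf_le (hmem fun _ => a)).trans hupper) ?_
  refine le_csInf (Set.nonempty_of_mem (hmem fun _ => a)) ?_
  rintro _ ⟨_, ⟨v, rfl⟩, rfl⟩
  rw [hdiff v]
  exact hlower _
end

section
/- Let m, n be positive integers with 3 ≤ n ≤ m, g_1, …, g_n ∈ F_{2^m} linearly independent over F_2, and k = 1. Let f(x) = x^4 + b x^2 + c x with b, c ∈ F_{2^m}, and σ_f = (f(g_1), …, f(g_n)). Then d_R(σ_f, G) = n − 2 (i.e., σ_f is not a deep hole of the Gabidulin code G of dimension 1) if and only if there exist two distinct nonzero elements β_1, β_2 of the F_2-span ⟨g_1, …, g_n⟩ such that β_1² + β_1β_2 + β_2² = b. -/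
/-- The additive quartic `x ↦ x⁴ + b x² + d x`, as a linear map over the field with two elements. -/
def additiveQuartic {Fq F : Type} [Field Fq] [Fintype Fq] [Field F] [CharP F 2] [Algebra Fq F]
    (hq : Fintype.card Fq = 2) (b d : F) : F →ₗ[Fq] F where
  toFun x := x ^ 4 + b * x ^ 2 + d * x
  map_add' x y := by
    have h : (x + y) ^ 2 = x ^ 2 + y ^ 2 := add_pow_char x y 2
    have h' : (x + y) ^ 4 = x ^ 4 + y ^ 4 := add_pow_char_pow x y 2 2
    rw [h, h']
    ring
  map_smul' r x := by
    have h : r ^ 2 = r := hq ▸ FiniteField.pow_card r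
    have h' : r ^ 4 = r := by rw [show r ^ 4 = (r ^ 2) ^ 2 by ring, h, h]
    simp only [smul_pow, h, h', RingHom.id_apply, smul_add, mul_smul_comm]

section

variable {Fq F : Type} [Field Fq] [Fintype Fq] [Field F] [CharP F 2] [Algebra Fq F]

@[simp]
lemma additiveQuartic_apply (hq : Fintype.card Fq = 2) (b d x : F) :
    additiveQuartic hq b d x = x ^ 4 + b * x ^ 2 + d * x := rfl

lemma finrank_ker_additiveQuartic_le [Finite F] (hq : Fintype.card Fq = 2) (b d : F) :
    Module.finrank Fq (LinearMap.ker (additiveQuartic hq b d)) ≤ 2 := by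
  classical
  open Polynomial in
  let p : F[X] := X ^ 4 + C b * X ^ 2 + C d * X
  have hdeg : p.natDegree = 4 := by simp only [p]; compute_degree!
  have hp : p ≠ 0 := by
    rintro h
    simp [h] at hdeg
  have hsub : (LinearMap.ker (additiveQuartic hq b d) : Set F) ⊆ p.roots.toFinset := by
    intro x hx
    simpa [hp, p] using hx
  have hcard : Nat.card (LinearMap.ker (additiveQuartic hq b d)) ≤ 4 := by
    calc _ ≤ (p.roots.toFinset : Set F).ncard := Set.ncard_le_ncard hsub
      _ = p.roots.toFinset.card := Set.ncard_coe_finset _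
      _ ≤ 4 := (Multiset.toFinset_card_le _).trans (hdeg ▸ p.card_roots')
  rw [Module.natCard_eq_pow_finrank (K := Fq), Nat.card_eq_fintype_card, hq] at hcard
  exact (Nat.pow_le_pow_iff_right (a := 2) (by norm_num)).1 hcard

/-- Over the field with two elements, distinct nonzero vectors span a plane. -/
lemma two_le_finrank_of_ne {M : Type*} [AddCommGroup M] [Module Fq M] [Module.Finite Fq M]
    (hq : Fintype.card Fq = 2) {x y : M} (hx : x ≠ 0) (hy : y ≠ 0) (hxy : x ≠ y) :
    2 ≤ Module.finrank Fq M := by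
  have hli : LinearIndependent Fq ![x, y] := by
    rw [LinearIndependent.pair_iff' hx]
    rintro a rfl
    have h : a ^ 2 = a := hq ▸ FiniteField.pow_card a
    have h01 : a * (a - 1) = 0 := by linear_combination h
    rcases mul_eq_zero.1 h01 with h | h
    · simp [h] at hy
    · simp [sub_eq_zero.1 h] at hxy
  simpa using hli.fintype_card_le_finrank

lemma finrank_span_additiveQuartic_add [Finite F] (hq : Fintype.card Fq = 2) {n : ℕ}
    {g : Fin n → F} (hg : LinearIndependent Fq g) (b d : F) :
    Module.finrank Fq (Submodule.span Fq (Set.range (additiveQuartic hq b d ∘ g))) +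
      Module.finrank Fq
        (Submodule.span Fq (Set.range g) ⊓ LinearMap.ker (additiveQuartic hq b d) :
          Submodule Fq F) = n := by
  rw [← Submodule.map_comap_subtype, ← LinearMap.ker_domRestrict,
    ← (Submodule.equivMapOfInjective _ (Submodule.injective_subtype _) _).finrank_eq,
    Set.range_comp, ← Submodule.map_span, ← LinearMap.range_domRestrict,
    LinearMap.finrank_range_add_finrank_ker, finrank_span_eq_card hg, Fintype.card_fin]

/-- Distinct nonzero `x`, `y` are common zeros of some quartic `X⁴ + b X² + d X` exactly when
`x² + x y + y² = b`. -/
lemma exists_additiveQuartic_eq_zero_iff (hq : Fintype.card Fq = 2) {b x y : F}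
    (hx : x ≠ 0) (hy : y ≠ 0) (hxy : x ≠ y) :
    (∃ d, additiveQuartic hq b d x = 0 ∧ additiveQuartic hq b d y = 0) ↔
      x ^ 2 + x * y + y ^ 2 = b := by
  have h2 : (2 : F) = 0 := CharTwo.two_eq_zero
  constructor
  · rintro ⟨d, h₁, h₂⟩
    simp only [additiveQuartic_apply] at h₁ h₂
    refine mul_left_cancel₀ (mul_ne_zero (mul_ne_zero hx hy) (sub_ne_zero.2 hxy)) ?_
    linear_combination y * h₁ - x * h₂ - b * x * y * (x - y) * h2
  · rintro rfl
    refine ⟨x * y * (x + y), ?_, ?_⟩ <;> simp only [additiveQuartic_apply]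
    · linear_combination (x ^ 4 + x ^ 3 * y + x ^ 2 * y ^ 2) * h2
    · linear_combination (y ^ 4 + y ^ 3 * x + x ^ 2 * y ^ 2) * h2

end

/-- Proposition 7 (first part): over `F_{2^m}` with `k = 1` and `3 ≤ n ≤ m`, for
`f(x) = x⁴ + b x² + c x` the word `σ_f` is not a deep hole (i.e. `d_R(σ_f, G) = n - 2`)
iff there are distinct nonzero `β₁, β₂` in the `F_2`-span of `g_1, …, g_n` with
`β₁² + β₁β₂ + β₂² = b`. -/
theorem binary_dim_one_not_deep_hole_iff
    (m n : ℕ) (hm : 0 < m) (hn : 3 ≤ n) (hnm : n ≤ m)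
    (Fq F : Type) [Field Fq] [Fintype Fq] [Field F] [Fintype F] [Algebra Fq F]
    (hcardFq : Fintype.card Fq = 2) (hcardF : Fintype.card F = 2 ^ m)
    (g : Fin n → F) (hg : LinearIndependent Fq g)
    (b c : F)
    (σf : Fin n → F)
    (hσf : σf = fun j => g j ^ 4 + b * g j ^ 2 + c * g j) :
    rankDistTo Fq σf (gabidulinCode 2 g 1) = n - 2 ↔
      ∃ β₁ β₂ : F, β₁ ∈ Submodule.span Fq (Set.range g) ∧
        β₂ ∈ Submodule.span Fq (Set.range g) ∧
        β₁ ≠ β₂ ∧ β₁ ≠ 0 ∧ β₂ ≠ 0 ∧ β₁ ^ 2 + β₁ * β₂ + β₂ ^ 2 = b := by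
  have : CharP F 2 := by
    have : Fact (Nat.Prime 2) := ⟨Nat.prime_two⟩
    exact charP_of_card_eq_prime_pow hcardF
  have hset : {r : ℕ | ∃ w ∈ gabidulinCode 2 g 1,
      r = Module.finrank Fq (Submodule.span Fq (Set.range (σf - w)))} =
      Set.range fun d => Module.finrank Fq
        (Submodule.span Fq (Set.range (additiveQuartic hcardFq b d ∘ g))) := by
    have hsub (v : Fin 1 → F) : σf - (fun j => ∑ i : Fin 1, v i * g j ^ 2 ^ (i : ℕ)) =
        additiveQuartic hcardFq b (c - v 0) ∘ g := by
      ext j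
      simp only [hσf, Pi.sub_apply, Function.comp_apply, additiveQuartic_apply,
        Fin.sum_univ_one, Fin.val_zero, pow_zero, pow_one]
      ring
    ext r
    constructor
    · rintro ⟨_, ⟨v, rfl⟩, rfl⟩
      exact ⟨c - v 0, by rw [hsub]⟩
    · rintro ⟨d, rfl⟩
      exact ⟨_, ⟨fun _ => c - d, rfl⟩, by rw [hsub, sub_sub_cancel]⟩
  have hle (d : F) := (Submodule.finrank_mono (inf_le_right (a := Submodule.span Fq (Set.range g))
    (b := LinearMap.ker (additiveQuartic hcardFq b d)))).trans
      (finrank_ker_additiveQuartic_le hcardFq b d)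
  have hadd := finrank_span_additiveQuartic_add hcardFq hg b
  rw [rankDistTo, hset]
  constructor
  · intro h
    obtain ⟨d, hd⟩ := h ▸ Nat.sInf_mem (Set.range_nonempty _)
    have hker : Module.finrank Fq
        (Submodule.span Fq (Set.range g) ⊓ LinearMap.ker (additiveQuartic hcardFq b d) :
          Submodule Fq F) = 2 := by
      have := hadd d
      simp only at hd
      omega
    let B := Module.finBasisOfFinrankEq Fq _ hker
    have hne (i : Fin 2) : (B i : F) ≠ 0 := by
      simpa using B.ne_zero i
    have hne' : (B 0 : F) ≠ B 1 := fun h => zero_ne_one (B.injective (Subtype.ext h))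
    exact ⟨_, _, (B 0).2.1, (B 1).2.1, hne', hne 0, hne 1,
      (exists_additiveQuartic_eq_zero_iff hcardFq (hne 0) (hne 1) hne').1
        ⟨d, (B 0).2.2, (B 1).2.2⟩⟩
  · rintro ⟨x, y, hxV, hyV, hxy, hx, hy, h⟩
    obtain ⟨d, hdx, hdy⟩ := (exists_additiveQuartic_eq_zero_iff hcardFq hx hy hxy).2 h
    have hker : 2 ≤ Module.finrank Fq
        (Submodule.span Fq (Set.range g) ⊓ LinearMap.ker (additiveQuartic hcardFq b d) :
          Submodule Fq F) :=
      two_le_finrank_of_ne hcardFq (x := ⟨x, hxV, hdx⟩) (y := ⟨y, hyV, hdy⟩)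
        (mt (congrArg Subtype.val) hx) (mt (congrArg Subtype.val) hy)
        (mt (congrArg Subtype.val) hxy)
    apply le_antisymm
    · refine (Nat.sInf_le (Set.mem_range_self d)).trans ?_
      have := hadd d
      omega
    · refine le_csInf (Set.range_nonempty _) ?_
      rintro _ ⟨e, rfl⟩
      have := hadd e
      have := hle e
      simp only
      omega
end

section
/- Let m ≥ 3 and let g_1, …, g_m be an F_2-basis of F_{2^m} (so n = m ≥ 3), and k = 1. Let f(x) = x^4 + b x^2 + c x with b, c ∈ F_{2^m}, and σ_f = (f(g_1), …, f(g_m)). Then d_R(σ_f, G) = m − 1 (i.e., σ_f is a deep hole of the Gabidulin code G of dimension 1) if and only if b = 0 and m is odd. -/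
/-- The linearized polynomial `x ^ 4 + b * x ^ 2 + e * x` as a linear map over the prime field. -/
def quarticLinearMap (Fq : Type) {F : Type} [Field Fq] [Field F] [Algebra Fq F] [CharP F 2]
    (hq : ∀ s : Fq, s ^ 2 = s) (b e : F) : F →ₗ[Fq] F where
  toFun x := x ^ 4 + b * x ^ 2 + e * x
  map_add' x y := by
    have h2 : (2 : F) = 0 := CharTwo.two_eq_zero
    linear_combination (2 * x ^ 3 * y + 3 * x ^ 2 * y ^ 2 + 2 * x * y ^ 3 + b * x * y) * h2
  map_smul' s x := by
    have hs : (algebraMap Fq F s) ^ 2 = algebraMap Fq F s := by rw [← map_pow, hq]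
    simp only [Algebra.smul_def, RingHom.id_apply]
    linear_combination (x ^ 4 * ((algebraMap Fq F s) ^ 2 + algebraMap Fq F s + 1)
      + b * x ^ 2) * hs

/-- Over a field whose elements are idempotent, a space has dimension at most one iff it has at
most one nonzero vector. -/
theorem finrank_le_one_iff_of_idempotent {Fq V : Type} [Field Fq] [AddCommGroup V] [Module Fq V]
    [FiniteDimensional Fq V] (hq : ∀ s : Fq, s ^ 2 = s) :
    Module.finrank Fq V ≤ 1 ↔ ∀ x y : V, x ≠ 0 → y ≠ 0 → x = y := by
  have key : ∀ (s : Fq) (v : V), s • v ≠ 0 → s • v = v := by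
    intro s v h
    have hs : s ≠ 0 := by rintro rfl; simp at h
    have : s = 1 := mul_left_cancel₀ hs (by rw [← sq, hq, mul_one])
    rw [this, one_smul]
  constructor
  · intro h x y hx hy
    obtain ⟨v, hv⟩ := finrank_le_one_iff.mp h
    obtain ⟨s, rfl⟩ := hv x
    obtain ⟨t, rfl⟩ := hv y
    rw [key s v hx, key t v hy]
  · intro h
    by_cases h0 : ∃ v : V, v ≠ 0
    · obtain ⟨v, hv⟩ := h0
      refine finrank_le_one v fun w => ?_
      by_cases hw : w = 0
      · exact ⟨0, by simp [hw]⟩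
      · exact ⟨1, by rw [one_smul]; exact h v w hv hw⟩
    · push Not at h0
      exact finrank_le_one 0 fun w => ⟨0, by simp [h0 w]⟩

theorem not_cube_root_of_odd {F : Type} [Field F] [Fintype F] [CharP F 2] {m : ℕ}
    (hcard : Fintype.card F = 2 ^ m) (hm : Odd m) (t : F) : t ^ 2 + t + 1 ≠ 0 := by
  intro ht
  have h2 : (2 : F) = 0 := CharTwo.two_eq_zero
  have h3 : t ^ 3 = 1 := by linear_combination (t - 1) * ht
  obtain ⟨k, rfl⟩ := hm
  have hmod : 2 ^ (2 * k + 1) % 3 = 2 := by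
    rw [pow_succ, pow_mul, Nat.mul_mod, Nat.pow_mod]; simp
  have hpow : t ^ 2 ^ (2 * k + 1) = t := hcard ▸ FiniteField.pow_card t
  rw [← Nat.div_add_mod (2 ^ (2 * k + 1)) 3, hmod, pow_add, pow_mul, h3, one_pow, one_mul] at hpow
  exact one_ne_zero (α := F) (by linear_combination ht - hpow - t * h2)

theorem exists_cube_root_of_even {F : Type} [Field F] [Fintype F] {m : ℕ}
    (hcard : Fintype.card F = 2 ^ m) (hm : Even m) :
    ∃ t : F, t ≠ 0 ∧ t ≠ 1 ∧ t ^ 2 + t + 1 = 0 := by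
  classical
  have hdvd : 3 ∣ Fintype.card Fˣ := by
    rw [Fintype.card_units, hcard]
    obtain ⟨k, rfl⟩ := hm
    have h4 : 2 ^ (k + k) % 3 = 1 := by
      rw [← two_mul, pow_mul, Nat.pow_mod]; simp
    omega
  have : Fact (Nat.Prime 3) := ⟨Nat.prime_three⟩
  obtain ⟨u, hu⟩ := exists_prime_orderOf_dvd_card 3 hdvd
  have h1 : (u : F) ≠ 1 := by
    intro h
    rw [Units.val_eq_one.mp h, orderOf_one] at hu
    omega
  have h3 : (u : F) ^ 3 = 1 := by
    rw [← Units.val_pow_eq_pow_val, ← hu, pow_orderOf_eq_one, Units.val_one]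
  refine ⟨u, u.ne_zero, h1, mul_left_cancel₀ (sub_ne_zero.mpr h1) ?_⟩
  linear_combination h3

theorem exists_pow_three_ne_one {F : Type} [Field F] [Fintype F] (hcard : 4 < Fintype.card F) :
    ∃ t : F, t ≠ 0 ∧ t ^ 3 ≠ 1 := by
  classical
  obtain ⟨u, hu⟩ := IsCyclic.exists_ofOrder_eq_natCard (α := Fˣ)
  refine ⟨u, u.ne_zero, fun h => ?_⟩
  have h3 : u ^ 3 = 1 := Units.ext (by simpa using h)
  have hle := Nat.le_of_dvd (by norm_num) (orderOf_dvd_of_pow_eq_one h3)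
  rw [hu, Nat.card_eq_fintype_card, Fintype.card_units] at hle
  omega

/-- In characteristic two the form `x ^ 2 + x * y + y ^ 2` represents `b` at distinct nonzero
arguments unless `b = 0` and the degree of the field is odd. -/
theorem exists_form_eq_iff {F : Type} [Field F] [Fintype F] [CharP F 2] {m : ℕ} (hm : 3 ≤ m)
    (hcard : Fintype.card F = 2 ^ m) (b : F) :
    (∃ x y : F, x ≠ 0 ∧ y ≠ 0 ∧ x ≠ y ∧ x ^ 2 + x * y + y ^ 2 = b) ↔ ¬(b = 0 ∧ Odd m) := by
  constructor
  · rintro ⟨x, y, -, hy, -, hxy⟩ ⟨rfl, hodd⟩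
    refine not_cube_root_of_odd hcard hodd (x / y) ?_
    field_simp
    linear_combination hxy
  · intro h
    by_cases hb : b = 0
    · obtain ⟨t, h0, h1, ht⟩ := exists_cube_root_of_even hcard
        (Nat.not_odd_iff_even.mp fun ho => h ⟨hb, ho⟩)
      exact ⟨t, 1, h0, one_ne_zero, h1, by rw [hb]; linear_combination ht⟩
    · have h4 : 4 < Fintype.card F := by
        rw [hcard]
        calc 4 < 2 ^ 3 := by norm_num
          _ ≤ 2 ^ m := Nat.pow_le_pow_right (by norm_num) hm
      obtain ⟨t, h0, h3⟩ := exists_pow_three_ne_one h4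
      have ht : t ^ 2 + t + 1 ≠ 0 := fun ht => h3 (by linear_combination (t - 1) * ht)
      obtain ⟨y, hy⟩ := FiniteField.isSquare_of_char_two (CharP.ringChar_of_prime_eq_zero
        Nat.prime_two (by simpa using (CharTwo.two_eq_zero : (2 : F) = 0))) (b / (t ^ 2 + t + 1))
      have hy0 : y ≠ 0 := by
        rintro rfl
        simp [hb, ht] at hy
      refine ⟨t * y, y, mul_ne_zero h0 hy0, hy0, fun h => h3 ?_, ?_⟩
      · rw [mul_right_cancel₀ hy0 (h.trans (one_mul y).symm), one_pow]
      · rw [div_eq_iff ht] at hy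
        linear_combination -hy

/-- Proposition 7 (second part): over `F_{2^m}` with `k = 1` and `n = m ≥ 3`, for
`f(x) = x⁴ + b x² + c x` the word `σ_f` is a deep hole (i.e. `d_R(σ_f, G) = m - 1`)
iff `b = 0` and `m` is odd. -/
theorem binary_dim_one_full_length_deep_hole_iff
    (m : ℕ) (hm : 3 ≤ m)
    (Fq F : Type) [Field Fq] [Fintype Fq] [Field F] [Fintype F] [Algebra Fq F]
    (hcardFq : Fintype.card Fq = 2) (hcardF : Fintype.card F = 2 ^ m)
    (g : Fin m → F) (hg : LinearIndependent Fq g)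
    (b c : F)
    (σf : Fin m → F)
    (hσf : σf = fun j => g j ^ 4 + b * g j ^ 2 + c * g j) :
    rankDistTo Fq σf (gabidulinCode 2 g 1) = m - 1 ↔ b = 0 ∧ Odd m := by
  have hq : ∀ s : Fq, s ^ 2 = s := fun s => hcardFq ▸ FiniteField.pow_card s
  have h2 : (2 : F) = 0 := by
    have h := Nat.cast_card_eq_zero F
    rw [hcardF, Nat.cast_pow] at h
    exact_mod_cast eq_zero_of_pow_eq_zero h
  have : CharP F 2 := CharTwo.of_one_ne_zero_of_two_eq_zero one_ne_zero h2
  have hfin : Module.finrank Fq F = m := by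
    have h := Module.card_eq_pow_finrank (K := Fq) (V := F)
    rw [hcardFq, hcardF] at h
    exact (Nat.pow_right_injective le_rfl h).symm
  have hspan : Submodule.span Fq (Set.range g) = ⊤ :=
    hg.span_eq_top_of_card_eq_finrank' (by rw [Fintype.card_fin, hfin])
  have hset : {r : ℕ | ∃ w ∈ gabidulinCode 2 g 1,
      r = Module.finrank Fq (Submodule.span Fq (Set.range (σf - w)))} =
      Set.range fun e => Module.finrank Fq (LinearMap.range (quarticLinearMap Fq hq b e)) := by
    have hrange : ∀ a : F, Submodule.span Fq (Set.range (σf - fun j => a * g j)) =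
        LinearMap.range (quarticLinearMap Fq hq b (c - a)) := by
      intro a
      rw [LinearMap.range_eq_map, ← hspan, Submodule.map_span, ← Set.range_comp]
      congr 2
      funext j
      simp only [hσf, Pi.sub_apply, Function.comp_apply, quarticLinearMap, LinearMap.coe_mk,
        AddHom.coe_mk]
      ring
    ext r
    constructor
    · rintro ⟨w, ⟨v, rfl⟩, rfl⟩
      have hw : (fun j => ∑ i : Fin 1, v i * g j ^ 2 ^ (i : ℕ)) = fun j => v 0 * g j := by simp
      exact ⟨c - v 0, by rw [hw, hrange]⟩
    · rintro ⟨e, rfl⟩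
      refine ⟨fun j => (c - e) * g j, ⟨fun _ => c - e, by simp⟩, ?_⟩
      rw [hrange, sub_sub_cancel]
  have hrank : ∀ e, Module.finrank Fq (LinearMap.range (quarticLinearMap Fq hq b e)) +
      Module.finrank Fq (LinearMap.ker (quarticLinearMap Fq hq b e)) = m :=
    fun e => by rw [LinearMap.finrank_range_add_finrank_ker, hfin]
  have hker : (∃ e, ¬ Module.finrank Fq (LinearMap.ker (quarticLinearMap Fq hq b e)) ≤ 1) ↔
      ¬(b = 0 ∧ Odd m) := by
    rw [← exists_form_eq_iff hm hcardF b]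
    simp only [finrank_le_one_iff_of_idempotent hq]
    constructor
    · rintro ⟨e, he⟩
      push Not at he
      obtain ⟨⟨x, hx⟩, ⟨y, hy⟩, hx0, hy0, hxy⟩ := he
      simp only [ne_eq, Submodule.mk_eq_zero, Subtype.mk.injEq] at hx0 hy0 hxy
      replace hx : x ^ 4 + b * x ^ 2 + e * x = 0 := hx
      replace hy : y ^ 4 + b * y ^ 2 + e * y = 0 := hy
      refine ⟨x, y, hx0, hy0, hxy, ?_⟩
      refine mul_left_cancel₀ (mul_ne_zero (mul_ne_zero hx0 hy0) (sub_ne_zero.mpr hxy)) ?_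
      linear_combination y * hx - x * hy - b * x * y * (x - y) * h2
    · rintro ⟨x, y, hx0, hy0, hxy, h⟩
      refine ⟨x ^ 3 + b * x, fun hall => hxy ?_⟩
      have hx : x ∈ LinearMap.ker (quarticLinearMap Fq hq b (x ^ 3 + b * x)) := by
        change x ^ 4 + b * x ^ 2 + (x ^ 3 + b * x) * x = 0
        linear_combination (x ^ 4 + b * x ^ 2) * h2
      have hy : y ∈ LinearMap.ker (quarticLinearMap Fq hq b (x ^ 3 + b * x)) := by
        change y ^ 4 + b * y ^ 2 + (x ^ 3 + b * x) * y = 0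
        linear_combination (-y * (x + y)) * h + y * (x ^ 3 + x ^ 2 * y + x * y ^ 2 + y ^ 3) * h2
      exact congrArg Subtype.val (hall ⟨x, hx⟩ ⟨y, hy⟩ (by simpa using hx0) (by simpa using hy0))
  rw [← not_iff_not, ← hker, rankDistTo, hset]
  constructor
  · contrapose!
    intro hall
    have hpos : 0 < Module.finrank Fq (LinearMap.ker (quarticLinearMap Fq hq b (1 + b))) := by
      have h1 : (1 : F) ∈ LinearMap.ker (quarticLinearMap Fq hq b (1 + b)) := by
        change (1 : F) ^ 4 + b * 1 ^ 2 + (1 + b) * 1 = 0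
        linear_combination (1 + b) * h2
      exact Module.finrank_pos_iff_exists_ne_zero.mpr ⟨⟨1, h1⟩, by simp⟩
    refine le_antisymm ((Nat.sInf_le (Set.mem_range_self (1 + b))).trans ?_) (le_csInf (Set.range_nonempty _) ?_)
    · have := hrank (1 + b)
      omega
    · rintro _ ⟨e, rfl⟩
      have := hrank e
      have := hall e
      dsimp only
      omega
  · rintro ⟨e, he⟩ heq
    have hle := Nat.sInf_le (Set.mem_range_self (f := fun e =>
      Module.finrank Fq (LinearMap.range (quarticLinearMap Fq hq b e))) e)
    rw [heq] at hle
    have := hrank e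
    omega
end
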